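/- There exists a positive integer n₁ such that for all integers n ≥ n₁ and m with 1 ≤ m ≤ n/3, every 3-graph H on n vertices with e(H) > f(n,m,3) satisfies ν(H) ≥ m. -/

import Mathlib

open Finset

/-- `f(n,m,k) = max{C(n,k) - C(n-m+1,k), C(km-1,k)}`. -/
def fEMC (n m k : ℕ) : ℕ :=
  max (Nat.choose n k - Nat.choose (n - m + 1) k) (Nat.choose (k * m - 1) k)

/-- `F` is a `k`-graph on the vertex set `[n] = {1,…,n}`. -/
def IsKGraphOn (n k : ℕ) (F : Finset (Finset ℕ)) : Prop :=
  ∀ e ∈ F, e ⊆ Finset.Icc 1 n ∧ e.card = k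

/-- The family `F = (F_1,…,F_m)` admits a rainbow matching. -/
def HasRainbowMatching {m : ℕ} (F : Fin m → Finset (Finset ℕ)) : Prop :=
  ∃ e : Fin m → Finset ℕ, (∀ i, e i ∈ F i) ∧
    ∀ i j : Fin m, i ≠ j → Disjoint (e i) (e j)

/-- Degree of a vertex `v` in the hypergraph `F`. -/
def degOf (F : Finset (Finset ℕ)) (v : ℕ) : ℕ := (F.filter (fun e => v ∈ e)).card

/-- The family `F` of `k`-graphs on `[n]` is saturated. -/
def Saturated (n k : ℕ) {m : ℕ} (F : Fin m → Finset (Finset ℕ)) : Prop :=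
  ¬ HasRainbowMatching F ∧
    ∀ (i : Fin m) (e : Finset ℕ), e ⊆ Finset.Icc 1 n → e.card = k → e ∉ F i →
      HasRainbowMatching (Function.update F i (insert e (F i)))

/-- Elementwise domination order: the increasing enumeration of `e` is
pointwise at most that of `f` (this forces `e.card = f.card`). -/
def DomLE (e f : Finset ℕ) : Prop :=
  List.Forall₂ (· ≤ ·) (e.sort (· ≤ ·)) (f.sort (· ≤ ·))

/-- `F` is a stable hypergraph on vertex set `[n]`. -/
def StableGraph (n : ℕ) (F : Finset (Finset ℕ)) : Prop :=
  ∀ e f : Finset ℕ, e ⊆ Finset.Icc 1 n → DomLE e f → f ∈ F → e ∈ F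

/-- `S(n,m,k)`: all `k`-subsets of `[n]` meeting `[m-1]`. -/
def SGraph (n m k : ℕ) : Finset (Finset ℕ) :=
  ((Finset.Icc 1 n).powersetCard k).filter (fun e => (e ∩ Finset.Icc 1 (m - 1)).Nonempty)

/-- `D(n,m,k)`: all `k`-subsets of `[km-1]`. -/
def DGraph (n m k : ℕ) : Finset (Finset ℕ) :=
  (Finset.Icc 1 (k * m - 1)).powersetCard k

/-- `H(F)`: the `(k+1)`-graph on `[n] ∪ {v_1,…,v_m}`, where `v_i` is encoded
as the natural number `n + i`, with edges `e ∪ {v_i}` for `e ∈ F_i`. -/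
def HF (n : ℕ) {m : ℕ} (F : Fin m → Finset (Finset ℕ)) : Finset (Finset ℕ) :=
  Finset.univ.biUnion (fun i : Fin m => (F i).image (fun e => insert (n + i.1 + 1) e))

/-- `H_S(n,m,k) = H(F)` with every `F_i = S(n,m,k)`. -/
def HS (n m k : ℕ) : Finset (Finset ℕ) := HF n (fun _ : Fin m => SGraph n m k)

/-- `H_D(n,m,k) = H(F)` with every `F_i = D(n,m,k)`. -/
def HD (n m k : ℕ) : Finset (Finset ℕ) := HF n (fun _ : Fin m => DGraph n m k)

/-- `H*(F)`: `H(F)` together with the edges `e ∪ {u_j}`, `e` a `k`-subset of `[n]`,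
`j ∈ [r]`, `r = ⌊n/k⌋ - m`, where `u_j` is encoded as the natural number `n + m + j`. -/
def HstarF (n k : ℕ) {m : ℕ} (F : Fin m → Finset (Finset ℕ)) : Finset (Finset ℕ) :=
  HF n F ∪ Finset.univ.biUnion (fun j : Fin (n / k - m) =>
    ((Finset.Icc 1 n).powersetCard k).image (fun e => insert (n + m + j.1 + 1) e))

/-- A set of edges is a matching if its edges are pairwise disjoint. -/
def IsMatching (M : Finset (Finset ℕ)) : Prop :=
  ∀ e ∈ M, ∀ f ∈ M, e ≠ f → Disjoint e f

/-- `H₂` is `ε`-close to `H₁` (as `u`-graphs on a vertex set of size `N`):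
`|E(H₁) \ E(H₂)| ≤ ε · N^u`. -/
def IsEpsClose (ε : ℝ) (N u : ℕ) (H₁ H₂ : Finset (Finset ℕ)) : Prop :=
  (((H₁ \ H₂).card : ℝ)) ≤ ε * (N : ℝ) ^ u

theorem psi_i (x y z : ℝ) (hx : 0 ≤ x) (hy : 0 ≤ y) (hz : 0 ≤ z) (h : x+y+z ≤ 1) :
    0 ≤ 3 + (x-1/3)*(14/5+34/5*(y+z)*(1-(y+z))) + (y-1/3)*(14/5+34/5*(x+z)*(1-(x+z))) + (z-1/3)*(14/5+34/5*(x+y)*(1-(x+y))) := by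
  have h1 : 9*(x*y*z) ≤ (x*y+y*z+z*x)*(x+y+z) := by
    nlinarith [mul_nonneg hx (sq_nonneg (y-z)), mul_nonneg hy (sq_nonneg (x-z)), mul_nonneg hz (sq_nonneg (x-y))]
  have h2 : 0 ≤ (x*y+y*z+z*x)*(1-(x+y+z)) := by
    apply mul_nonneg
    · positivity
    · linarith
  nlinarith [sq_nonneg (x+y+z-1/5), sq_nonneg (x+y+z)]
theorem psi_ii (x y z : ℝ) (h0 : 0≤x+y+z-1) (h1 : 0≤1-x-y) (h2 : 0≤y-z) (h3 : 0≤x-y) :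
    0 ≤ -(49/100)*0 + (x-1/3)*(14/5+34/5*(y+z)*(1-(y+z))) + (y-1/3)*(14/5+34/5*(x+z)*(1-(x+z))) + (z-1/3)*(14/5+34/5*(x+y)*(1-(x+y))) := by
  linarith [mul_nonneg (mul_nonneg h0 h0) h0,
    mul_nonneg (mul_nonneg h0 h0) h1,
    mul_nonneg (mul_nonneg h0 h0) h2,
    mul_nonneg (mul_nonneg h0 h0) h3,
    mul_nonneg (mul_nonneg h0 h1) h1,
    mul_nonneg (mul_nonneg h0 h1) h2,
    mul_nonneg (mul_nonneg h0 h1) h3,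
    mul_nonneg (mul_nonneg h0 h2) h2,
    mul_nonneg (mul_nonneg h0 h2) h3,
    mul_nonneg (mul_nonneg h0 h3) h3,
    mul_nonneg (mul_nonneg h1 h1) h1,
    mul_nonneg (mul_nonneg h1 h1) h2,
    mul_nonneg (mul_nonneg h1 h1) h3,
    mul_nonneg (mul_nonneg h1 h2) h2,
    mul_nonneg (mul_nonneg h1 h2) h3,
    mul_nonneg (mul_nonneg h1 h3) h3,
    mul_nonneg (mul_nonneg h2 h2) h2,
    mul_nonneg (mul_nonneg h2 h2) h3,
    mul_nonneg (mul_nonneg h2 h3) h3,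
    mul_nonneg (mul_nonneg h3 h3) h3]
theorem psi_iii (x y z : ℝ) (h0 : 0≤x+y-1) (h1 : 0≤1-x-z) (h2 : 0≤z) (h3 : 0≤x-y) :
    0 ≤ -(49/100)*1 + (x-1/3)*(14/5+34/5*(y+z)*(1-(y+z))) + (y-1/3)*(14/5+34/5*(x+z)*(1-(x+z))) + (z-1/3)*(15/4-49/20*(x+y)^2+34/5*(x*y)) := by
  linarith [mul_nonneg (mul_nonneg h0 h0) h0,
    mul_nonneg (mul_nonneg h0 h0) h1,
    mul_nonneg (mul_nonneg h0 h0) h2,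
    mul_nonneg (mul_nonneg h0 h0) h3,
    mul_nonneg (mul_nonneg h0 h1) h1,
    mul_nonneg (mul_nonneg h0 h1) h2,
    mul_nonneg (mul_nonneg h0 h1) h3,
    mul_nonneg (mul_nonneg h0 h2) h2,
    mul_nonneg (mul_nonneg h0 h2) h3,
    mul_nonneg (mul_nonneg h0 h3) h3,
    mul_nonneg (mul_nonneg h1 h1) h1,
    mul_nonneg (mul_nonneg h1 h1) h2,
    mul_nonneg (mul_nonneg h1 h1) h3,
    mul_nonneg (mul_nonneg h1 h2) h2,
    mul_nonneg (mul_nonneg h1 h2) h3,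
    mul_nonneg (mul_nonneg h1 h3) h3,
    mul_nonneg (mul_nonneg h2 h2) h2,
    mul_nonneg (mul_nonneg h2 h2) h3,
    mul_nonneg (mul_nonneg h2 h3) h3,
    mul_nonneg (mul_nonneg h3 h3) h3]
theorem psi_iv (x y z : ℝ) (h0 : 0≤x+z-1) (h1 : 0≤1-y-z) (h2 : 0≤y-z) (h3 : 0≤1-x) :
    0 ≤ -(49/100)*2 + (x-1/3)*(14/5+34/5*(y+z)*(1-(y+z))) + (y-1/3)*(15/4-49/20*(x+z)^2+34/5*(x*z)) + (z-1/3)*(15/4-49/20*(x+y)^2+34/5*(x*y)) := by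
  linarith [mul_nonneg (mul_nonneg h0 h0) h0,
    mul_nonneg (mul_nonneg h0 h0) h1,
    mul_nonneg (mul_nonneg h0 h0) h2,
    mul_nonneg (mul_nonneg h0 h0) h3,
    mul_nonneg (mul_nonneg h0 h1) h1,
    mul_nonneg (mul_nonneg h0 h1) h2,
    mul_nonneg (mul_nonneg h0 h1) h3,
    mul_nonneg (mul_nonneg h0 h2) h2,
    mul_nonneg (mul_nonneg h0 h2) h3,
    mul_nonneg (mul_nonneg h0 h3) h3,
    mul_nonneg (mul_nonneg h1 h1) h1,
    mul_nonneg (mul_nonneg h1 h1) h2,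
    mul_nonneg (mul_nonneg h1 h1) h3,
    mul_nonneg (mul_nonneg h1 h2) h2,
    mul_nonneg (mul_nonneg h1 h2) h3,
    mul_nonneg (mul_nonneg h1 h3) h3,
    mul_nonneg (mul_nonneg h2 h2) h2,
    mul_nonneg (mul_nonneg h2 h2) h3,
    mul_nonneg (mul_nonneg h2 h3) h3,
    mul_nonneg (mul_nonneg h3 h3) h3]
theorem psi_v (x y z : ℝ) (h0 : 0≤y+z-1) (h1 : 0≤1-x) (h2 : 0≤x-y) (h3 : 0≤y-z) :
    0 ≤ -(49/100)*3 + (x-1/3)*(15/4-49/20*(y+z)^2+34/5*(y*z)) + (y-1/3)*(15/4-49/20*(x+z)^2+34/5*(x*z)) + (z-1/3)*(15/4-49/20*(x+y)^2+34/5*(x*y)) := by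
  linarith [mul_nonneg (mul_nonneg h0 h0) h0,
    mul_nonneg (mul_nonneg h0 h0) h1,
    mul_nonneg (mul_nonneg h0 h0) h2,
    mul_nonneg (mul_nonneg h0 h0) h3,
    mul_nonneg (mul_nonneg h0 h1) h1,
    mul_nonneg (mul_nonneg h0 h1) h2,
    mul_nonneg (mul_nonneg h0 h1) h3,
    mul_nonneg (mul_nonneg h0 h2) h2,
    mul_nonneg (mul_nonneg h0 h2) h3,
    mul_nonneg (mul_nonneg h0 h3) h3,
    mul_nonneg (mul_nonneg h1 h1) h1,
    mul_nonneg (mul_nonneg h1 h1) h2,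
    mul_nonneg (mul_nonneg h1 h1) h3,
    mul_nonneg (mul_nonneg h1 h2) h2,
    mul_nonneg (mul_nonneg h1 h2) h3,
    mul_nonneg (mul_nonneg h1 h3) h3,
    mul_nonneg (mul_nonneg h2 h2) h2,
    mul_nonneg (mul_nonneg h2 h2) h3,
    mul_nonneg (mul_nonneg h2 h3) h3,
    mul_nonneg (mul_nonneg h3 h3) h3]

/-- the weight function in the pointwise inequality -/
noncomputable def lam (x y : ℝ) : ℝ :=
  if 1 ≤ x + y then 15/4-49/20*(x+y)^2+34/5*(x*y) else 14/5+34/5*(x+y)*(1-(x+y))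

theorem lam_comm (x y : ℝ) : lam x y = lam y x := by
  unfold lam; rw [add_comm y x, mul_comm y x]

theorem lam_nonneg {x y : ℝ} (hx : 0 ≤ x) (hy : 0 ≤ y) (hx1 : x ≤ 1) (hy1 : y ≤ 1) : 0 ≤ lam x y := by
  unfold lam; split_ifs with h
  · nlinarith [mul_nonneg (sub_nonneg.2 hx1) (sub_nonneg.2 hy1), sq_nonneg (x-y)]
  · nlinarith [mul_nonneg (add_nonneg hx hy) (by linarith : 0 ≤ 1-(x+y))]

theorem lam_le {x y : ℝ} (hx : 0 ≤ x) (hy : 0 ≤ y) (hx1 : x ≤ 1) (hy1 : y ≤ 1) : lam x y ≤ 5 := by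
  unfold lam; split_ifs with h
  · nlinarith [sq_nonneg (x-y)]
  · nlinarith [sq_nonneg (x+y-1/2)]

/-- indicator -/
noncomputable def ind2 (x y : ℝ) : ℝ := if 1 ≤ x + y then 1 else 0
/-- indicator -/
noncomputable def ind3 (x y z : ℝ) : ℝ := if x + y + z < 1 then 1 else 0

/-- the pointwise expression -/
noncomputable def Psi (x y z : ℝ) : ℝ :=
  3 * ind3 x y z - 49/100 * (ind2 y z + ind2 x z + ind2 x y) +
    ((x-1/3) * lam y z + (y-1/3) * lam x z + (z-1/3) * lam x y)

theorem Psi_swap12 (x y z : ℝ) : Psi x y z = Psi y x z := by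
  unfold Psi ind3 ind2
  rw [lam_comm x y, add_comm x y]; ring

theorem Psi_swap23 (x y z : ℝ) : Psi x y z = Psi x z y := by
  unfold Psi ind3 ind2
  rw [lam_comm y z, add_comm y z, add_right_comm x y z]; ring

theorem Psi_sorted {x y z : ℝ} (hxy : y ≤ x) (hyz : z ≤ y) (hz : 0 ≤ z) (hx1 : x ≤ 1) : 0 ≤ Psi x y z := by
  unfold Psi ind3 ind2 lam
  by_cases h1 : x + y + z < 1
  · have := psi_i x y z (by linarith) (by linarith) hz h1.le
    rw [if_pos h1, if_neg (by linarith), if_neg (by linarith), if_neg (by linarith),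
      if_neg (by linarith), if_neg (by linarith), if_neg (by linarith)]
    linarith
  rw [if_neg h1]
  by_cases h2 : 1 ≤ y + z
  · have := psi_v x y z (by linarith) (by linarith) (by linarith) (by linarith)
    rw [if_pos h2, if_pos (by linarith), if_pos (by linarith),
      if_pos (by linarith), if_pos (by linarith), if_pos (by linarith)]
    linarith
  rw [if_neg h2, if_neg h2]
  by_cases h3 : 1 ≤ x + z
  · have := psi_iv x y z (by linarith) (by linarith) (by linarith) (by linarith)
    rw [if_pos h3, if_pos (by linarith), if_pos (by linarith), if_pos (by linarith)]
    linarith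
  rw [if_neg h3, if_neg h3]
  by_cases h4 : 1 ≤ x + y
  · have := psi_iii x y z (by linarith) (by linarith) (by linarith) (by linarith)
    rw [if_pos h4, if_pos (by linarith)]
    linarith
  rw [if_neg h4, if_neg h4]
  have := psi_ii x y z (by linarith) (by linarith) (by linarith) (by linarith)
  linarith

theorem Psi_nonneg {x y z : ℝ} (hx : 0 ≤ x) (hx1 : x ≤ 1) (hy : 0 ≤ y) (hy1 : y ≤ 1)
    (hz : 0 ≤ z) (hz1 : z ≤ 1) : 0 ≤ Psi x y z := by
  rcases le_total x y with h1 | h1 <;> rcases le_total y z with h2 | h2 <;>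
    rcases le_total x z with h3 | h3
  · rw [Psi_swap12, Psi_swap23, Psi_swap12]; exact Psi_sorted h2 h1 hx hz1
  · have e1 : x = y := by linarith
    have e2 : y = z := by linarith
    subst e1; subst e2; exact Psi_sorted le_rfl le_rfl hx hx1
  · rw [Psi_swap12, Psi_swap23]; exact Psi_sorted h2 h3 hx hy1
  · rw [Psi_swap12]; exact Psi_sorted h1 h3 hz hy1
  · rw [Psi_swap23, Psi_swap12]; exact Psi_sorted h3 h1 hy hz1
  · rw [Psi_swap23]; exact Psi_sorted h3 h2 hy hx1
  · have e1 : x = y := by linarith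
    have e2 : y = z := by linarith
    subst e1; subst e2; exact Psi_sorted le_rfl le_rfl hx hx1
  · exact Psi_sorted h1 h2 hz hx1

theorem sum_Psi (V : Finset ℕ) (W : ℕ → ℝ) :
    ∑ x ∈ V, ∑ y ∈ V, ∑ z ∈ V, Psi (W x) (W y) (W z) =
      3 * (∑ x ∈ V, ∑ y ∈ V, ∑ z ∈ V, ind3 (W x) (W y) (W z))
      - 3 * (49/100) * V.card * (∑ x ∈ V, ∑ y ∈ V, ind2 (W x) (W y))
      + 3 * ((∑ x ∈ V, W x) - V.card / 3) * (∑ x ∈ V, ∑ y ∈ V, lam (W x) (W y)) := by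
  have key1 : ∀ g : ℕ → ℕ → ℝ, ∑ x ∈ V, ∑ y ∈ V, ∑ z ∈ V, g y z = V.card * ∑ x ∈ V, ∑ y ∈ V, g x y := by
    intro g; simp
  have key2 : ∀ g : ℕ → ℕ → ℝ, ∑ x ∈ V, ∑ y ∈ V, ∑ z ∈ V, g x z = V.card * ∑ x ∈ V, ∑ y ∈ V, g x y := by
    intro g; simp [Finset.mul_sum]
  have key3 : ∀ g : ℕ → ℕ → ℝ, ∑ x ∈ V, ∑ y ∈ V, ∑ z ∈ V, g x y = V.card * ∑ x ∈ V, ∑ y ∈ V, g x y := by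
    intro g; simp [Finset.mul_sum]
  have l1 : ∑ x ∈ V, ∑ y ∈ V, ∑ z ∈ V, (W x - 1/3) * lam (W y) (W z) =
      ((∑ x ∈ V, W x) - V.card / 3) * (∑ x ∈ V, ∑ y ∈ V, lam (W x) (W y)) := by
    simp_rw [← Finset.mul_sum]
    rw [← Finset.sum_mul, Finset.sum_sub_distrib]
    simp; left; ring
  have l2 : ∑ x ∈ V, ∑ y ∈ V, ∑ z ∈ V, (W y - 1/3) * lam (W x) (W z) =
      ((∑ x ∈ V, W x) - V.card / 3) * (∑ x ∈ V, ∑ y ∈ V, lam (W x) (W y)) := by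
    rw [Finset.sum_comm, l1]
  have l3 : ∑ x ∈ V, ∑ y ∈ V, ∑ z ∈ V, (W z - 1/3) * lam (W x) (W y) =
      ((∑ x ∈ V, W x) - V.card / 3) * (∑ x ∈ V, ∑ y ∈ V, lam (W x) (W y)) := by
    rw [← l2]
    apply Finset.sum_congr rfl; intro x _; rw [Finset.sum_comm]
  unfold Psi
  simp only [Finset.sum_add_distrib, Finset.sum_sub_distrib, ← Finset.mul_sum]
  simp only [Finset.mul_sum] at l1 l2 l3 ⊢
  simp only [← Finset.mul_sum] at ⊢
  have k1 := key1 (fun a b => ind2 (W a) (W b))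
  have k2 := key2 (fun a b => ind2 (W a) (W b))
  have k3 := key3 (fun a b => ind2 (W a) (W b))
  simp only [← Finset.mul_sum] at l1 l2 l3
  simp only [] at k1 k2 k3
  rw [k1, k2, k3, l1, l2, l3]
  ring

theorem ind3_sum_le (V : Finset ℕ) (W : ℕ → ℝ) (K : Finset (Finset ℕ))
    (hK : ∀ e ∈ K, 1 ≤ ∑ v ∈ e, W v) :
    ∑ x ∈ V, ∑ y ∈ V, ∑ z ∈ V, ind3 (W x) (W y) (W z) ≤
      6 * ((V.powersetCard 3).filter (fun e => e ∉ K)).card + 3 * (V.card : ℝ)^2 := by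
  classical
  let D := ((V ×ˢ V ×ˢ V).filter (fun p : ℕ × ℕ × ℕ => W p.1 + W p.2.1 + W p.2.2 < 1 ∧
    p.1 ≠ p.2.1 ∧ p.1 ≠ p.2.2 ∧ p.2.1 ≠ p.2.2))
  have hD : D.card ≤ 6 * ((V.powersetCard 3).filter (fun e => e ∉ K)).card := by
    have h1 : D.card ≤ 6 * (D.image (fun p : ℕ × ℕ × ℕ => ({p.1, p.2.1, p.2.2} : Finset ℕ))).card := by
      apply Finset.card_le_mul_card_image
      intro e he
      obtain ⟨⟨a, b, c⟩, hp, rfl⟩ := Finset.mem_image.1 he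
      have hs : (D.filter (fun q => ({q.1, q.2.1, q.2.2} : Finset ℕ) = {a, b, c})) ⊆
        {(a,b,c),(a,c,b),(b,a,c),(b,c,a),(c,a,b),(c,b,a)} := by
        rintro ⟨x, y, z⟩ hq
        simp only [D, Finset.mem_filter, Finset.mem_product] at hq
        obtain ⟨⟨_, _, h1, h2, h3⟩, h4⟩ := hq
        have ha : x ∈ ({a,b,c} : Finset ℕ) := by rw [← h4]; simp
        have hb : y ∈ ({a,b,c} : Finset ℕ) := by rw [← h4]; simp
        have hc : z ∈ ({a,b,c} : Finset ℕ) := by rw [← h4]; simp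
        simp only [Finset.mem_insert, Finset.mem_singleton, Prod.mk.injEq] at ha hb hc ⊢
        grind
      exact (Finset.card_le_card hs).trans Finset.card_le_six
    refine h1.trans (Nat.mul_le_mul_left _ (Finset.card_le_card ?_))
    intro e he
    obtain ⟨⟨a, b, c⟩, hp, rfl⟩ := Finset.mem_image.1 he
    simp only [D, Finset.mem_filter, Finset.mem_product] at hp
    obtain ⟨⟨h1, h2, h3⟩, h4, h5, h6, h7⟩ := hp
    simp only [Finset.mem_filter, Finset.mem_powersetCard]
    refine ⟨⟨by grind, Finset.card_eq_three.2 ⟨a, b, c, h5, h6, h7, rfl⟩⟩, fun h => ?_⟩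
    have := hK _ h
    rw [Finset.sum_insert (by simp; tauto), Finset.sum_insert (by simp; tauto), Finset.sum_singleton] at this
    linarith
  have hle : ∀ x y z : ℕ, ind3 (W x) (W y) (W z) ≤
     (if (W x + W y + W z < 1 ∧ x ≠ y ∧ x ≠ z ∧ y ≠ z) then (1:ℝ) else 0) +
      (if x = y then (1:ℝ) else 0) + (if x = z then (1:ℝ) else 0) + (if y = z then (1:ℝ) else 0) := by
    intro x y z; unfold ind3
    split_ifs <;> simp_all <;> norm_num
  have hDc : (D.card : ℝ) = ∑ x ∈ V, ∑ y ∈ V, ∑ z ∈ V, 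
     (if (W x + W y + W z < 1 ∧ x ≠ y ∧ x ≠ z ∧ y ≠ z) then (1:ℝ) else 0) := by
    simp only [D]
    rw [Finset.card_filter, Nat.cast_sum, Finset.sum_product]
    apply Finset.sum_congr rfl; intro x _
    rw [Finset.sum_product]
    push_cast; rfl
  have : ∑ x ∈ V, ∑ y ∈ V, ∑ z ∈ V, ind3 (W x) (W y) (W z) ≤ D.card + 3 * (V.card : ℝ)^2 := by
    refine (Finset.sum_le_sum fun x _ => Finset.sum_le_sum fun y _ => Finset.sum_le_sum fun z _ => hle x y z).trans ?_
    simp only [Finset.sum_add_distrib]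
    rw [← hDc]
    simp
    have e1 : ∑ x ∈ V, ∑ y ∈ V, (if x = y then (V.card:ℝ) else 0) = V.card * V.card := by
      simp
    have e2 : ∑ x ∈ V, (if x ∈ V then (V.card:ℝ) else 0) = V.card * V.card := by
      rw [Finset.sum_congr rfl (fun x hx => if_pos hx)]; simp
    have e3 : ∑ x ∈ V, (if x ∈ V then (1:ℝ) else 0) = V.card := by
      rw [Finset.sum_congr rfl (fun x hx => if_pos hx)]; simp
    nlinarith [e1, e2, e3]
  have hD' : (D.card : ℝ) ≤ 6 * ((V.powersetCard 3).filter (fun e => e ∉ K)).card := by exact_mod_cast hD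
  linarith

theorem ind2_sum_ge (V : Finset ℕ) (W : ℕ → ℝ) (L : Finset (Finset ℕ)) (hLV : ∀ e ∈ L, e ⊆ V ∧ e.card = 2)
    (hL : ∀ e ∈ L, 1 ≤ ∑ v ∈ e, W v) :
    2 * (L.card : ℝ) ≤ ∑ x ∈ V, ∑ y ∈ V, ind2 (W x) (W y) := by
  classical
  have h1 : (L.biUnion (fun e => e.offDiag)).card = 2 * L.card := by
    rw [Finset.card_biUnion]
    · rw [Finset.sum_congr rfl (fun e he => by rw [Finset.offDiag_card, (hLV e he).2])]
      simp [mul_comm]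
    · intro e he f hf hef
      rw [Function.onFun, Finset.disjoint_left]
      rintro ⟨x, y⟩ hx hy
      apply hef
      rw [Finset.mem_offDiag] at hx hy
      have e1 : ({x, y} : Finset ℕ) = e := Finset.eq_of_subset_of_card_le (by grind) (by
        rw [(hLV e he).2, Finset.card_pair hx.2.2])
      have e2 : ({x, y} : Finset ℕ) = f := Finset.eq_of_subset_of_card_le (by grind) (by
        rw [(hLV f hf).2, Finset.card_pair hx.2.2])
      rw [← e1, e2]
  have h2 : (∑ x ∈ V, ∑ y ∈ V, ind2 (W x) (W y)) = (((V ×ˢ V).filter (fun p => 1 ≤ W p.1 + W p.2)).card : ℝ) := by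
    rw [Finset.card_filter, Nat.cast_sum, Finset.sum_product]
    push_cast; rfl
  rw [h2]
  have h3 : (L.biUnion (fun e => e.offDiag)).card ≤ ((V ×ˢ V).filter (fun p => 1 ≤ W p.1 + W p.2)).card := by
    apply Finset.card_le_card
    rintro ⟨x, y⟩ hx
    rw [Finset.mem_biUnion] at hx
    obtain ⟨e, he, hx⟩ := hx
    rw [Finset.mem_offDiag] at hx
    have e1 : ({x, y} : Finset ℕ) = e := Finset.eq_of_subset_of_card_le (by grind) (by
        rw [(hLV e he).2, Finset.card_pair hx.2.2])
    have := hL e he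
    rw [← e1, Finset.sum_pair hx.2.2] at this
    simp only [Finset.mem_filter, Finset.mem_product]
    exact ⟨⟨(hLV e he).1 hx.1, (hLV e he).1 hx.2.1⟩, this⟩
  rw [h1] at h3
  exact_mod_cast h3

theorem lam_sum_bounds (V : Finset ℕ) (W : ℕ → ℝ) (h0 : ∀ v, 0 ≤ W v) (h1 : ∀ v, W v ≤ 1) :
    0 ≤ (∑ x ∈ V, ∑ y ∈ V, lam (W x) (W y)) ∧ (∑ x ∈ V, ∑ y ∈ V, lam (W x) (W y)) ≤ 5 * (V.card : ℝ)^2 := by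
  constructor
  · exact Finset.sum_nonneg fun x _ => Finset.sum_nonneg fun y _ => lam_nonneg (h0 _) (h0 _) (h1 _) (h1 _)
  · calc (∑ x ∈ V, ∑ y ∈ V, lam (W x) (W y)) ≤ ∑ x ∈ V, ∑ y ∈ V, (5:ℝ) :=
        Finset.sum_le_sum fun x _ => Finset.sum_le_sum fun y _ => lam_le (h0 _) (h0 _) (h1 _) (h1 _)
      _ = _ := by simp; ring

/-- Conclusion of the cover argument. -/
theorem cover_ineq (V : Finset ℕ) (W : ℕ → ℝ) (K L : Finset (Finset ℕ)) (δ : ℝ) (hδ : 0 ≤ δ)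
    (h0 : ∀ v, 0 ≤ W v) (h1 : ∀ v, W v ≤ 1)
    (hK : ∀ e ∈ K, 1 ≤ ∑ v ∈ e, W v)
    (hLV : ∀ e ∈ L, e ⊆ V ∧ e.card = 2)
    (hL : ∀ e ∈ L, 1 ≤ ∑ v ∈ e, W v) (hW : ∑ v ∈ V, W v ≤ V.card / 3 + δ) :
    49/100 * 2 * V.card * L.card ≤ 6 * (((V.powersetCard 3).filter (fun e => e ∉ K)).card : ℝ) + 3 * (V.card : ℝ)^2
      + 5 * δ * (V.card : ℝ)^2 := by
  have hΨ : 0 ≤ ∑ x ∈ V, ∑ y ∈ V, ∑ z ∈ V, Psi (W x) (W y) (W z) :=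
    Finset.sum_nonneg fun x _ => Finset.sum_nonneg fun y _ => Finset.sum_nonneg fun z _ =>
      Psi_nonneg (h0 _) (h1 _) (h0 _) (h1 _) (h0 _) (h1 _)
  rw [sum_Psi] at hΨ
  have a := ind3_sum_le V W K hK
  have b := ind2_sum_ge V W L hLV hL
  obtain ⟨c, d⟩ := lam_sum_bounds V W h0 h1
  set A := ∑ x ∈ V, ∑ y ∈ V, ∑ z ∈ V, ind3 (W x) (W y) (W z)
  set B := ∑ x ∈ V, ∑ y ∈ V, ind2 (W x) (W y)
  set Λ := ∑ x ∈ V, ∑ y ∈ V, lam (W x) (W y)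
  have e1 : ((∑ x ∈ V, W x) - V.card / 3) * Λ ≤ δ * Λ := by
    apply mul_le_mul_of_nonneg_right _ c; linarith
  have e2 : δ * Λ ≤ δ * (5 * (V.card : ℝ)^2) := mul_le_mul_of_nonneg_left d hδ
  have e3 : (V.card:ℝ) * (2 * L.card) ≤ V.card * B := mul_le_mul_of_nonneg_left b (by positivity)
  nlinarith

/-- closed under decreasing injective maps -/
def ShiftClosed (E : Finset (Finset ℕ)) : Prop :=
  ∀ e ∈ E, ∀ φ : ℕ → ℕ, Set.InjOn φ e → (∀ v ∈ e, 1 ≤ φ v ∧ φ v ≤ v) → e.image φ ∈ E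

/-- `k` pairwise disjoint edges -/
def HasM (E : Finset (Finset ℕ)) (k : ℕ) : Prop :=
  ∃ g : Fin k → Finset ℕ, (∀ i, g i ∈ E) ∧ ∀ i j, i ≠ j → Disjoint (g i) (g j)

theorem exists_inj_lt {α : Type*} (X : Finset α) (B : ℕ) (h : X.card ≤ B) :
    ∃ f : α → ℕ, Set.InjOn f X ∧ ∀ x ∈ X, f x < B := by
  classical
  refine ⟨fun x => if h : x ∈ X then (X.equivFin ⟨x, h⟩).val else 0, ?_, ?_⟩
  · intro x hx y hy hxy
    have hx' : x ∈ X := hx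
    have hy' : y ∈ X := hy
    simp only [hx', hy', dif_pos] at hxy
    have := X.equivFin.injective (Fin.ext hxy)
    simpa using this
  · intro x hx
    simp only [hx, dif_pos]
    exact lt_of_lt_of_le (Fin.is_lt _) h

theorem pack {α : Type*} (E : Finset (Finset ℕ)) (hE : ShiftClosed E) (P : Finset α)
    (ed : α → Finset ℕ) (hed : ∀ p ∈ P, ed p ∈ E) (B : ℕ) (hB : 0 < B)
    (h0 : ∀ p ∈ P, ∀ v ∈ ed p, B ≤ v)
    (hload : ∀ i, ∑ p ∈ P, ((ed p).filter (fun v => v / B = i)).card ≤ B) :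
    ∃ g : α → Finset ℕ, (∀ p ∈ P, g p ∈ E) ∧ ∀ p ∈ P, ∀ q ∈ P, p ≠ q → Disjoint (g p) (g q) := by
  classical
  have hX : ∀ i, ∃ f : (Σ _ : α, ℕ) → ℕ, Set.InjOn f (P.sigma (fun p => (ed p).filter (fun v => v / B = i))) ∧
      ∀ x ∈ (P.sigma (fun p => (ed p).filter (fun v => v / B = i))), f x < B := by
    intro i
    apply exists_inj_lt
    rw [Finset.card_sigma]; exact hload i
  choose f hf1 hf2 using hX
  let φ : α → ℕ → ℕ := fun p v => (v / B - 1) * B + f (v / B) ⟨p, v⟩ + 1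
  have hmem : ∀ p ∈ P, ∀ v ∈ ed p, (⟨p, v⟩ : Σ _ : α, ℕ) ∈ (P.sigma (fun p => (ed p).filter (fun w => w / B = v / B))) := by
    intro p hp v hv
    simp [hp, hv]
  have hge : ∀ p ∈ P, ∀ v ∈ ed p, 1 ≤ v / B := by
    intro p hp v hv
    exact (Nat.one_le_div_iff hB).2 (h0 p hp v hv)
  have hinj : ∀ p ∈ P, ∀ v ∈ ed p, ∀ q ∈ P, ∀ w ∈ ed q, φ p v = φ q w → p = q ∧ v = w := by
    intro p hp v hv q hq w hw h
    have h1 := hf2 _ _ (hmem p hp v hv)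
    have h2 := hf2 _ _ (hmem q hq w hw)
    have h3 := hge p hp v hv
    have h4 := hge q hq w hw
    simp only [φ, Nat.add_right_cancel_iff] at h
    have hd : (v / B - 1) = (w / B - 1) := by
      have e1 : ((v / B - 1) * B + f (v / B) ⟨p, v⟩) / B = v / B - 1 := by
        rw [mul_comm, Nat.mul_add_div hB, Nat.div_eq_of_lt h1, add_zero]
      have e2 : ((w / B - 1) * B + f (w / B) ⟨q, w⟩) / B = w / B - 1 := by
        rw [mul_comm, Nat.mul_add_div hB, Nat.div_eq_of_lt h2, add_zero]
      rw [← e1, h, e2]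
    have hd' : v / B = w / B := by omega
    rw [hd'] at h
    have h5 : f (w / B) ⟨p, v⟩ = f (w / B) ⟨q, w⟩ := by omega
    have h6 := hmem p hp v hv
    rw [hd'] at h6
    have := hf1 _ h6 (hmem q hq w hw) h5
    simpa using this
  refine ⟨fun p => (ed p).image (φ p), ?_, ?_⟩
  · intro p hp
    apply hE _ (hed p hp)
    · intro v hv w hw h
      exact (hinj p hp v hv p hp w hw h).2
    · intro v hv
      refine ⟨by simp [φ], ?_⟩
      have h1 := hf2 _ _ (hmem p hp v hv)
      have h3 := hge p hp v hv
      have h4 : v / B * B ≤ v := Nat.div_mul_le_self v B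
      simp only [φ]
      have : v / B * B = (v / B - 1) * B + B := by
        conv_lhs => rw [← Nat.sub_add_cancel h3]
        ring
      omega
  · intro p hp q hq hpq
    rw [Finset.disjoint_left]
    intro x hx hy
    obtain ⟨v, hv, rfl⟩ := Finset.mem_image.1 hx
    obtain ⟨w, hw, h⟩ := Finset.mem_image.1 hy
    exact hpq (hinj p hp v hv q hq w hw h.symm).1

theorem hasM_of_card {α : Type*} (E : Finset (Finset ℕ)) (P : Finset α) (g : α → Finset ℕ) (k : ℕ)
    (hk : k ≤ P.card) (h1 : ∀ p ∈ P, g p ∈ E) (h2 : ∀ p ∈ P, ∀ q ∈ P, p ≠ q → Disjoint (g p) (g q)) :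
    HasM E k := by
  let ι : Fin k → P := fun i => P.equivFin.symm (Fin.castLE hk i)
  have hι : Function.Injective ι := P.equivFin.symm.injective.comp (Fin.castLE_injective hk)
  refine ⟨fun i => g (ι i), fun i => h1 _ (ι i).2, fun i j hij => h2 _ (ι i).2 _ (ι j).2 ?_⟩
  intro h; exact hij (hι (Subtype.ext h))

/-- block type -/
noncomputable def tau (G B : ℕ) (e : Finset ℕ) : Fin G → ℝ :=
  fun i => ((e.filter (fun v => v / B = i)).card : ℝ)

theorem tau_card (G B : ℕ) (E : Finset (Finset ℕ)) (h3 : ∀ e ∈ E, e.card ≤ 3) :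
    (E.image (tau G B)).card ≤ 4 ^ G := by
  classical
  have : E.image (tau G B) ⊆ Fintype.piFinset (fun _ : Fin G => (Finset.range 4).image (Nat.cast : ℕ → ℝ)) := by
    intro t ht
    obtain ⟨e, he, rfl⟩ := Finset.mem_image.1 ht
    rw [Fintype.mem_piFinset]
    intro i
    apply Finset.mem_image_of_mem
    rw [Finset.mem_range]
    have := Finset.card_filter_le e (fun v => v / B = i)
    have := h3 e he
    omega
  refine (Finset.card_le_card this).trans ?_
  rw [Fintype.card_piFinset]
  simp only [Finset.prod_const, Finset.card_univ, Fintype.card_fin]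
  apply Nat.pow_le_pow_left
  exact Finset.card_image_le.trans (by simp)

theorem not_meet (E : Finset (Finset ℕ)) (hE : ShiftClosed E) (h3 : ∀ e ∈ E, e.card ≤ 3)
    (N G s B : ℕ) (hG : 0 < G) (hB : 0 < B) (hNB : N < G * B) (hV : ∀ e ∈ E, e ⊆ Finset.Icc 1 N)
    (hM : ¬ HasM E (s + 1)) (y : Fin G → ℝ) (hy : y ∈ convexHull ℝ (tau G B '' (E : Set (Finset ℕ)))) 
    (hyc : ∀ i, y i * ((s + 1 + B + 4 ^ G : ℕ) : ℝ) ≤ B) : False := by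
  classical
  set Q := s + 1 + B + 4 ^ G with hQ
  rw [← Finset.coe_image, Finset.mem_convexHull'] at hy
  obtain ⟨α, hα0, hα1, hαy⟩ := hy
  set T := E.image (tau G B) with hT
  have hrep : ∀ t ∈ T, ∃ e ∈ E, tau G B e = t := fun t ht => Finset.mem_image.1 ht
  choose! rep hrepE hrept using hrep
  let m : (Fin G → ℝ) → ℕ := fun t => ⌊α t * Q⌋₊
  have hm1 : ∀ t ∈ T, (m t : ℝ) ≤ α t * Q := fun t ht => 
    Nat.floor_le (mul_nonneg (hα0 t ht) (Nat.cast_nonneg _))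
  have hm2 : ∀ t ∈ T, α t * Q - 1 ≤ (m t : ℝ) := fun t ht => by
    have := Nat.lt_floor_add_one (α t * Q)
    simp only [m]; linarith
  have hTpos : ∀ t ∈ T, ∀ i, 0 ≤ t i := by
    intro t ht i
    rw [← hrept t ht]; exact Nat.cast_nonneg _
  have hload : ∀ i, ∑ t ∈ T, (m t : ℝ) * t i ≤ B := by
    intro i
    refine le_trans ?_ (hyc i)
    rw [← hαy, Finset.sum_apply, Finset.sum_mul]
    apply Finset.sum_le_sum
    intro t ht
    have := mul_le_mul_of_nonneg_right (hm1 t ht) (hTpos t ht i)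
    simp only [Pi.smul_apply, smul_eq_mul]
    linarith
  have htot : (Q : ℝ) - 4 ^ G ≤ ∑ t ∈ T, (m t : ℝ) := by
    have h1 : ∑ t ∈ T, (α t * Q - 1) ≤ ∑ t ∈ T, (m t : ℝ) := Finset.sum_le_sum hm2
    rw [Finset.sum_sub_distrib, ← Finset.sum_mul, hα1] at h1
    have h2 : (T.card : ℝ) ≤ 4 ^ G := by exact_mod_cast tau_card G B E h3
    simp at h1
    linarith
  let i0 : Fin G := ⟨0, hG⟩
  let T' := T.filter (fun t => t i0 = 0)
  have hbad : ∑ t ∈ T.filter (fun t => ¬ t i0 = 0), (m t : ℝ) ≤ B := by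
    refine le_trans ?_ (hload i0)
    rw [Finset.sum_filter]
    apply Finset.sum_le_sum
    intro t ht
    by_cases h : t i0 = 0
    · rw [if_neg (not_not.2 h), h, mul_zero]
    · rw [if_pos h]
      have : (1:ℝ) ≤ t i0 := by
        rw [← hrept t ht] at h ⊢
        simp only [tau] at h ⊢
        have h' : (filter (fun v => v / B = (i0 : ℕ)) (rep t)).card ≠ 0 := by exact_mod_cast h
        exact_mod_cast Nat.one_le_iff_ne_zero.2 h'
      have h0 : (0:ℝ) ≤ m t := Nat.cast_nonneg _
      nlinarith
  have hgood : s + 1 ≤ ∑ t ∈ T', m t := by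
    have := Finset.sum_filter_add_sum_filter_not T (fun t => t i0 = 0) (fun t => (m t : ℝ))
    have hc : ((s + 1 : ℕ) : ℝ) ≤ ((∑ t ∈ T', m t : ℕ) : ℝ) := by
      push_cast
      have hQ' : (Q : ℝ) = s + 1 + B + 4 ^ G := by rw [hQ]; push_cast; ring
      simp only [T']
      linarith
    exact_mod_cast hc
  let P : Finset (Σ _ : (Fin G → ℝ), ℕ) := T'.sigma (fun t => Finset.range (m t))
  have hP : ∀ p ∈ P, p.1 ∈ T ∧ p.1 i0 = 0 := by
    intro p hp
    have := (Finset.mem_sigma.1 hp).1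
    exact Finset.mem_filter.1 this
  obtain ⟨g, hg1, hg2⟩ := pack E hE P (fun p => rep p.1) (fun p hp => hrepE _ (hP p hp).1) B hB
    (by
      intro p hp v hv
      by_contra hlt
      obtain ⟨h1, h2⟩ := hP p hp
      rw [← hrept _ h1] at h2
      simp only [tau] at h2
      have h2' : (filter (fun v => v / B = (i0 : ℕ)) (rep p.1)).card = 0 := by exact_mod_cast h2
      rw [Finset.card_eq_zero] at h2'
      have : v ∈ (filter (fun v => v / B = (i0 : ℕ)) (rep p.1)) := by
        rw [Finset.mem_filter]; exact ⟨hv, Nat.div_eq_of_lt (by omega)⟩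
      rw [h2'] at this; simp at this)
    (by
      intro i
      by_cases hi : i < G
      · have h1 : ((∑ p ∈ P, ((rep p.1).filter (fun v => v / B = i)).card : ℕ) : ℝ) ≤ ((B : ℕ) : ℝ) := by
          refine le_trans (le_of_eq (b := ∑ t ∈ T', (m t : ℝ) * t ⟨i, hi⟩) ?_) (le_trans ?_ (hload ⟨i, hi⟩))
          · push_cast
            rw [Finset.sum_sigma]
            apply Finset.sum_congr rfl
            intro t ht
            have ht' := (Finset.mem_filter.1 ht).1
            simp only [Finset.sum_const, Finset.card_range, nsmul_eq_mul]
            have hh := congrFun (hrept t ht') ⟨i, hi⟩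
            rw [← hh]
            rfl
          · apply Finset.sum_le_sum_of_subset_of_nonneg (Finset.filter_subset _ _)
            intro t ht _
            exact mul_nonneg (Nat.cast_nonneg _) (hTpos t ht _)
        exact_mod_cast h1
      · rw [Finset.sum_eq_zero]
        · exact Nat.zero_le _
        · intro p hp
          rw [Finset.card_eq_zero, Finset.filter_eq_empty_iff]
          intro v hv hvi
          have h1 := hV _ (hrepE _ (hP p hp).1) hv
          rw [Finset.mem_Icc] at h1
          have : v / B < G := Nat.div_lt_of_lt_mul (by rw [mul_comm]; omega)
          omega)
  exact hM (hasM_of_card E P g (s+1) (by simpa [P, Finset.card_sigma] using hgood) hg1 hg2)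

theorem exists_cover (E : Finset (Finset ℕ)) (hE : ShiftClosed E) (h3 : ∀ e ∈ E, e.card ≤ 3)
    (N G s B : ℕ) (hG : 0 < G) (hB : 0 < B) (hNB : N < G * B) (hV : ∀ e ∈ E, e ⊆ Finset.Icc 1 N)
    (hM : ¬ HasM E (s + 1)) :
    ∃ W : ℕ → ℝ, (∀ v, 0 ≤ W v) ∧ (∀ v, W v ≤ 1) ∧ (∀ e ∈ E, 1 ≤ ∑ v ∈ e, W v) ∧
      ∑ v ∈ Finset.Icc 1 N, W v ≤ ((s + 1 + B + 4 ^ G : ℕ) : ℝ) := by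
  classical
  rcases E.eq_empty_or_nonempty with rfl | hne
  · exact ⟨fun _ => 0, by simp, by simp, by simp, by simp; positivity⟩
  set Q : ℕ := s + 1 + B + 4 ^ G with hQ
  have hQ0 : (0:ℝ) < Q := by rw [hQ]; positivity
  have hB0 : (0:ℝ) < B := by exact_mod_cast hB
  set c : ℝ := B / Q with hc
  have hc0 : 0 < c := by positivity
  have hdisj : Disjoint (convexHull ℝ (tau G B '' (E : Set (Finset ℕ)))) {y : Fin G → ℝ | ∀ i, y i ≤ c} := by
    rw [Set.disjoint_left]
    intro y hy hy'
    apply not_meet E hE h3 N G s B hG hB hNB hV hM y hy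
    intro i
    have := hy' i
    rw [hc, le_div_iff₀ hQ0] at this
    exact this
  have hcomp : IsCompact (convexHull ℝ (tau G B '' (E : Set (Finset ℕ)))) :=
    (Set.Finite.image _ E.finite_toSet).isCompact_convexHull (𝕜 := ℝ)
  have hDconv : Convex ℝ {y : Fin G → ℝ | ∀ i, y i ≤ c} := by
    have : {y : Fin G → ℝ | ∀ i, y i ≤ c} = Set.Iic (fun _ => c) := by
      ext y; rfl
    rw [this]; exact convex_Iic _
  have hDcl : IsClosed {y : Fin G → ℝ | ∀ i, y i ≤ c} := by
    have : {y : Fin G → ℝ | ∀ i, y i ≤ c} = Set.Iic (fun _ => c) := by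
      ext y; rfl
    rw [this]; exact isClosed_Iic
  obtain ⟨f, u, v, hu, huv, hv⟩ := geometric_hahn_banach_compact_closed (convex_convexHull ℝ _) hcomp hDconv hDcl hdisj
  let w : Fin G → ℝ := fun i => - f (Pi.single i 1)
  have hfw : ∀ y : Fin G → ℝ, f y = - ∑ i, w i * y i := by
    intro y
    have : y = ∑ i, y i • (Pi.single i (1:ℝ) : Fin G → ℝ) := by
      ext j; simp [Finset.sum_apply, Pi.single_apply]
    conv_lhs => rw [this]
    rw [map_sum, ← Finset.sum_neg_distrib]
    apply Finset.sum_congr rfl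
    intro i _
    simp [w]; ring
  have hw0 : ∀ i, 0 ≤ w i := by
    intro i
    by_contra hneg
    push Not at hneg
    let t : ℝ := (|v| + |∑ j, w j * c| + 1) / (- w i)
    have ht : 0 ≤ t := div_nonneg (by positivity) (by linarith)
    have h1 := hv (fun j => c - (if j = i then t else 0)) (by
      intro j; simp only; split_ifs <;> linarith)
    rw [hfw] at h1
    simp only [mul_sub, Finset.sum_sub_distrib] at h1
    simp only [mul_ite, mul_zero, Finset.sum_ite_eq', Finset.mem_univ, if_true] at h1
    have h2 : w i * t = -(|v| + |∑ j, w j * c| + 1) := by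
      have hwi : - w i ≠ 0 := by linarith
      have h3 : t * (- w i) = (|v| + |∑ j, w j * c| + 1) := div_mul_cancel₀ _ hwi
      linarith
    have := abs_le.1 (le_refl |v|)
    have := abs_le.1 (le_refl |∑ j, w j * c|)
    linarith [this.1, this.2]
  have hcv : c * ∑ i, w i < - v := by
    have h1 := hv (fun _ => c) (fun i => le_rfl)
    rw [hfw, ← Finset.sum_mul] at h1
    linarith
  have hsw : 0 ≤ ∑ i, w i := Finset.sum_nonneg fun i _ => hw0 i
  set θ := -v with hθ
  have hθ0 : 0 < θ := lt_of_le_of_lt (by positivity) hcv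
  have hτ : ∀ e ∈ E, θ ≤ ∑ i, w i * tau G B e i := by
    intro e he
    have h1 := hu _ (subset_convexHull ℝ _ (Set.mem_image_of_mem (tau G B) he))
    rw [hfw] at h1
    linarith
  let w' : ℕ → ℝ := fun x => if h : x / B < G then w ⟨x / B, h⟩ / θ else 0
  have hw'0 : ∀ x, 0 ≤ w' x := by
    intro x; simp only [w']; split_ifs
    · exact div_nonneg (hw0 _) hθ0.le
    · exact le_rfl
  have hsum : ∀ A : Finset ℕ, A ⊆ Finset.Icc 1 N → ∑ x ∈ A, w' x = (∑ i : Fin G, w i * ((A.filter (fun v => v / B = i)).card : ℝ)) / θ := by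
    intro A hA
    have hAG : ∀ x ∈ A, x / B < G := by
      intro x hx
      have := hA hx
      rw [Finset.mem_Icc] at this
      exact Nat.div_lt_of_lt_mul (by rw [mul_comm]; omega)
    have : ∀ x ∈ A, w' x = ∑ i : Fin G, if x / B = i then w i / θ else 0 := by
      intro x hx
      simp only [w', hAG x hx, dif_pos]
      rw [Finset.sum_eq_single (⟨x / B, hAG x hx⟩ : Fin G)]
      · simp
      · intro j _ hj
        rw [if_neg]
        intro h; apply hj; ext; simp [h]
      · simp
    rw [Finset.sum_congr rfl this, Finset.sum_comm, Finset.sum_div]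
    apply Finset.sum_congr rfl
    intro i _
    rw [← Finset.sum_filter, Finset.sum_const, nsmul_eq_mul]; ring
  refine ⟨fun x => min 1 (w' x), fun x => le_min zero_le_one (hw'0 x), fun x => min_le_left _ _, ?_, ?_⟩
  · intro e he
    by_cases hcap : ∃ x ∈ e, 1 ≤ w' x
    · obtain ⟨x, hx, h1⟩ := hcap
      have : min 1 (w' x) ≤ ∑ v ∈ e, min 1 (w' v) :=
        Finset.single_le_sum (f := fun v => min 1 (w' v)) (fun v _ => le_min zero_le_one (hw'0 v)) hx
      rwa [min_eq_left h1] at this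
    · push Not at hcap
      rw [Finset.sum_congr rfl (fun x hx => min_eq_right (hcap x hx).le), hsum e (hV e he), le_div_iff₀ hθ0, one_mul]
      exact hτ e he
  · have h1 : ∑ v ∈ Finset.Icc 1 N, min 1 (w' v) ≤ ∑ v ∈ Finset.Icc 1 N, w' v :=
      Finset.sum_le_sum fun v _ => min_le_right _ _
    refine h1.trans ?_
    rw [hsum _ (Finset.Subset.refl _), div_le_iff₀ hθ0]
    have h2 : ∀ i : Fin G, (((Finset.Icc 1 N).filter (fun v => v / B = i)).card : ℝ) ≤ B := by
      intro i
      have : ((Finset.Icc 1 N).filter (fun v => v / B = i)) ⊆ Finset.Ico (i * B) (i * B + B) := by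
        intro x hx
        rw [Finset.mem_filter] at hx
        rw [Finset.mem_Ico]
        have := Nat.div_add_mod x B
        have := Nat.mod_lt x hB
        rw [hx.2] at *
        rw [mul_comm]
        omega
      have := Finset.card_le_card this
      rw [Nat.card_Ico] at this
      exact_mod_cast (by omega : ((Finset.Icc 1 N).filter (fun v => v / B = i)).card ≤ B)
    have h3 : ∑ i : Fin G, w i * (((Finset.Icc 1 N).filter (fun v => v / B = i)).card : ℝ) ≤ ∑ i, w i * B :=
      Finset.sum_le_sum fun i _ => mul_le_mul_of_nonneg_left (h2 i) (hw0 i)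
    refine h3.trans ?_
    rw [← Finset.sum_mul]
    have h4 : (B:ℝ) = c * Q := by rw [hc]; field_simp
    rw [h4]
    nlinarith

theorem exists_perm_image {α : Type*} [Fintype α] [DecidableEq α] (e f : Finset α) (h : e.card = f.card) :
    ∃ σ : Equiv.Perm α, e.image σ = f := by
  let ε : {x // x ∈ e} ≃ {x // x ∈ f} := Finset.equivOfCardEq h
  refine ⟨ε.extendSubtype, ?_⟩
  apply Finset.eq_of_subset_of_card_le
  · intro x hx
    obtain ⟨y, hy, rfl⟩ := Finset.mem_image.1 hx
    exact ε.extendSubtype_mem y hy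
  · rw [Finset.card_image_of_injective _ (Equiv.injective _), h]

theorem perm_count {α : Type*} [Fintype α] [DecidableEq α] (e f g : Finset α) (h : f.card = g.card) :
    (univ.filter (fun σ : Equiv.Perm α => e.image σ = f)).card =
    (univ.filter (fun σ : Equiv.Perm α => e.image σ = g)).card := by
  obtain ⟨π, hπ⟩ := exists_perm_image f g h
  apply Finset.card_bij' (fun σ _ => π * σ) (fun σ _ => π⁻¹ * σ)
  · intro σ hσ
    simp only [mem_filter, mem_univ, true_and] at hσ ⊢
    rw [← hπ, ← hσ, Finset.image_image]; rfl
  · intro σ hσ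
    simp only [mem_filter, mem_univ, true_and] at hσ ⊢
    have : g.image (π⁻¹ : Equiv.Perm α) = f := by
      rw [← hπ, Finset.image_image]
      have : (⇑(π⁻¹) ∘ ⇑π) = id := by ext x; simp
      rw [this, Finset.image_id]
    rw [← this, ← hσ, Finset.image_image]; rfl
  · intro σ _; simp
  · intro σ _; simp

theorem averaging_aux {α : Type*} [Fintype α] [DecidableEq α] (K : Finset (Finset α)) (q s k : ℕ)
    (hK : ∀ e ∈ K, e.card = k) (t : Fin q → Finset α) (ht : ∀ i, (t i).card = k)
    (hs : ∀ σ : Equiv.Perm α, (univ.filter (fun i => (t i).image σ ∈ K)).card ≤ s) :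
    q * K.card ≤ s * (Fintype.card α).choose k := by
  rcases Nat.eq_zero_or_pos q with rfl | hq
  · simp
  let i0 : Fin q := ⟨0, hq⟩
  set c := (univ.filter (fun σ : Equiv.Perm α => (t i0).image σ = t i0)).card with hc
  have hc0 : 0 < c := by
    rw [hc, Finset.card_pos]; exact ⟨1, by simp⟩
  have hcc : ∀ e f : Finset α, e.card = k → f.card = k →
      (univ.filter (fun σ : Equiv.Perm α => e.image σ = f)).card = c := by
    intro e f he hf
    obtain ⟨π, hπ⟩ := exists_perm_image (t i0) e (by rw [ht, he])
    have h1 := perm_count e f e (by rw [he, hf])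
    rw [h1, hc]
    apply Finset.card_bij' (fun σ _ => π⁻¹ * σ * π) (fun σ _ => π * σ * π⁻¹)
    · intro σ hσ
      simp only [mem_filter, mem_univ, true_and] at hσ ⊢
      have h2 : (t i0).image (⇑(π⁻¹ * σ * π)) = ((((t i0).image π).image σ).image (⇑π⁻¹)) := by
        rw [Finset.image_image, Finset.image_image]; rfl
      rw [h2, hπ, hσ, ← hπ, Finset.image_image]
      have : (⇑(π⁻¹) ∘ ⇑π) = id := by ext x; simp
      rw [this, Finset.image_id]
    · intro σ hσ
      simp only [mem_filter, mem_univ, true_and] at hσ ⊢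
      have h2 : e.image (⇑(π * σ * π⁻¹)) = (((e.image (⇑π⁻¹)).image σ).image π) := by
        rw [Finset.image_image, Finset.image_image]; rfl
      have h3 : e.image (⇑π⁻¹) = t i0 := by
        rw [← hπ, Finset.image_image]
        have : (⇑(π⁻¹) ∘ ⇑π) = id := by ext x; simp
        rw [this, Finset.image_id]
      rw [h2, h3, hσ, hπ]
    · intro σ _; simp [mul_assoc]
    · intro σ _; simp [mul_assoc]
  have hsum : ∀ (i : Fin q) (J : Finset (Finset α)), (∀ e ∈ J, e.card = k) →
      (univ.filter (fun σ : Equiv.Perm α => (t i).image σ ∈ J)).card = J.card * c := by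
    intro i J hJ
    have := Finset.card_eq_sum_card_fiberwise (s := univ.filter (fun σ : Equiv.Perm α => (t i).image σ ∈ J))
      (t := J) (f := fun σ : Equiv.Perm α => (t i).image σ) (by intro σ hσ; simpa using hσ)
    rw [this, Finset.sum_const_nat]
    intro e he
    rw [← hcc (t i) e (ht i) (hJ e he)]
    congr 1
    ext σ
    simp only [mem_filter, mem_univ, true_and]
    constructor
    · exact fun h => h.2
    · exact fun h => ⟨h ▸ he, h⟩
  have htot : (Finset.univ : Finset (Equiv.Perm α)).card = (Fintype.card α).choose k * c := by
    have := hsum i0 (powersetCard k univ) (fun e he => (mem_powersetCard.1 he).2)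
    rw [card_powersetCard, card_univ] at this
    rw [← this]
    congr 1
    ext σ
    simp only [mem_univ, mem_filter, true_and, mem_powersetCard, true_iff]
    exact ⟨subset_univ _, by rw [Finset.card_image_of_injective _ (Equiv.injective _), ht]⟩
  have hdouble : ∑ σ : Equiv.Perm α, (univ.filter (fun i => (t i).image σ ∈ K)).card = q * (K.card * c) := by
    have := Finset.sum_card_bipartiteAbove_eq_sum_card_bipartiteBelow 
      (s := (univ : Finset (Equiv.Perm α))) (t := (univ : Finset (Fin q))) (fun (σ : Equiv.Perm α) i => (t i).image σ ∈ K)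
    unfold bipartiteAbove bipartiteBelow at this
    rw [this, Finset.sum_congr rfl (fun i _ => hsum i K hK)]
    simp
  have hle : ∑ σ : Equiv.Perm α, (univ.filter (fun i => (t i).image σ ∈ K)).card ≤ s * ((Fintype.card α).choose k * c) := by
    rw [← htot, mul_comm, ← smul_eq_mul]
    exact Finset.sum_le_card_nsmul _ _ _ (fun σ _ => hs σ)
  rw [hdouble] at hle
  apply Nat.le_of_mul_le_mul_right _ hc0
  calc q * K.card * c = q * (K.card * c) := by ring
    _ ≤ _ := hle
    _ = _ := by ring

theorem averaging (A : Finset ℕ) (K : Finset (Finset ℕ)) (q s k : ℕ)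
    (hK : ∀ e ∈ K, e ⊆ A ∧ e.card = k) (hq : k * q ≤ A.card) (hM : ¬ HasM K (s + 1)) :
    q * K.card ≤ s * A.card.choose k := by
  classical
  let K0 : Finset (Finset A) := univ.filter (fun e => e.image Subtype.val ∈ K)
  have hK0 : K0.card = K.card := by
    apply Finset.card_bij (fun e _ => e.image Subtype.val)
    · intro e he; simpa [K0] using he
    · intro e _ f _ h
      exact Finset.image_injective Subtype.val_injective h
    · intro e he
      refine ⟨e.subtype (· ∈ A), ?_, ?_⟩
      · simp only [K0, mem_filter, mem_univ, true_and]
        convert he using 1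
        ext x; simp; intro hx; exact (hK e he).1 hx
      · ext x; simp; intro hx; exact (hK e he).1 hx
  have : Nonempty (Fin q × Fin k ↪ A) := by
    apply Function.Embedding.nonempty_of_card_le
    simp; rw [mul_comm]; exact hq
  obtain ⟨ι⟩ := this
  let t : Fin q → Finset A := fun i => univ.image (fun j => ι (i, j))
  have := averaging_aux K0 q s k (by
      intro e he
      simp only [K0, mem_filter, mem_univ, true_and] at he
      rw [← (hK _ he).2, Finset.card_image_of_injective _ Subtype.val_injective]) t (by
      intro i
      simp only [t]
      rw [Finset.card_image_of_injective]
      · simp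
      · intro a b h
        simpa using ι.injective h) (by
      intro σ
      by_contra hlt
      apply hM
      apply hasM_of_card K (univ.filter (fun i => (t i).image σ ∈ K0)) (fun i => ((t i).image σ).image Subtype.val) (s+1)
        (by omega)
      · intro i hi
        simpa [K0] using hi
      · intro i _ j _ hij
        rw [Finset.disjoint_image Subtype.val_injective, Finset.disjoint_image (Equiv.injective _)]
        rw [Finset.disjoint_left]
        intro x hx hy
        simp only [t, mem_image, mem_univ, true_and] at hx hy
        obtain ⟨a, rfl⟩ := hx
        obtain ⟨b, hb⟩ := hy
        have := ι.injective hb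
        simp at this
        exact hij this.1.symm)
  rw [hK0, Fintype.card_coe] at this
  exact this

theorem choose_two_real (a : ℕ) : (a.choose 2 : ℝ) = a * (a - 1) / 2 := Nat.cast_choose_two ℝ a

theorem choose_three_real (a : ℕ) : (a.choose 3 : ℝ) = a * (a - 1) * (a - 2) / 6 := by
  have h := Nat.cast_choose_eq_descPochhammer_div ℝ a 3
  rw [h, show Nat.factorial 3 = 6 from rfl]
  simp [descPochhammer_succ_right]

theorem graph_structure (L : Finset (Finset ℕ)) (hsh : ShiftClosed L) (N p : ℕ)
    (hL : ∀ e ∈ L, e ⊆ Finset.Icc 1 N ∧ e.card = 2) (hM : ¬ HasM L (p + 1)) :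
    ∃ q ≤ p, L.card + (N - q).choose 2 ≤ N.choose 2 + (2 * (p - q) + 1).choose 2 := by
  classical
  have hj : ∃ q ≤ p, ({q + 1, 2 * p + 2 - q} : Finset ℕ) ∉ L := by
    by_contra hcon
    push Not at hcon
    apply hM
    refine ⟨fun i => {i.1 + 1, 2 * p + 2 - i.1}, fun i => hcon _ (by omega), ?_⟩
    intro i j hij
    have : i.1 ≠ j.1 := fun h => hij (Fin.ext h)
    rw [Finset.disjoint_left]
    intro x hx hy
    simp only [mem_insert, mem_singleton] at hx hy
    omega
  obtain ⟨q, hq, hqL⟩ := hj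
  refine ⟨q, hq, ?_⟩
  have hsub : L ⊆ (powersetCard 2 (Icc 1 N) \ powersetCard 2 (Icc (q+1) N)) ∪ powersetCard 2 (Icc (q+1) (2 * p + 1 - q)) := by
    intro e he
    obtain ⟨h1, h2⟩ := hL e he
    obtain ⟨x, y, hxy, rfl⟩ := Finset.card_eq_two.1 h2
    wlog hlt : x < y generalizing x y
    · have := this y x hxy.symm (by rwa [pair_comm]) (by rwa [pair_comm]) (by rwa [pair_comm]) (by omega)
      rwa [pair_comm] at this
    have hx := h1 (show x ∈ ({x, y} : Finset ℕ) by simp)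
    have hy := h1 (show y ∈ ({x, y} : Finset ℕ) by simp)
    rw [mem_Icc] at hx hy
    simp only [mem_union, mem_sdiff, mem_powersetCard, h2, and_true]
    by_cases hxq : x ≤ q
    · left
      refine ⟨h1, fun h => ?_⟩
      have := h (show x ∈ ({x, y} : Finset ℕ) by simp)
      rw [mem_Icc] at this; omega
    · right
      by_cases hyq : y ≤ 2 * p + 1 - q
      · intro z hz
        simp only [mem_insert, mem_singleton] at hz
        rw [mem_Icc]; omega
      · exfalso
        apply hqL
        have := hsh _ he (fun z => if z = x then q + 1 else 2 * p + 2 - q) (by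
          intro a ha b hb hab
          simp only [coe_insert, coe_singleton, Set.mem_insert_iff, Set.mem_singleton_iff] at ha hb
          simp only at hab
          split_ifs at hab <;> omega) (by
          intro v hv
          simp only [mem_insert, mem_singleton] at hv
          split_ifs <;> omega)
        rw [image_insert, image_singleton, if_pos rfl, if_neg (by omega)] at this
        exact this
  have h1 := (card_le_card hsub).trans (card_union_le _ _)
  rw [card_sdiff_of_subset (powersetCard_mono (Icc_subset_Icc (by omega) le_rfl)), card_powersetCard, card_powersetCard, card_powersetCard] at h1
  simp only [Nat.card_Icc] at h1
  have e1 : N + 1 - 1 = N := by omega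
  have e2 : N + 1 - (q + 1) = N - q := by omega
  have e3 : 2 * p + 1 - q + 1 - (q + 1) = 2 * (p - q) + 1 := by omega
  rw [e1, e2, e3] at h1
  have : (N - q).choose 2 ≤ N.choose 2 := Nat.choose_le_choose 2 (by omega)
  omega

theorem graph_real (L : Finset (Finset ℕ)) (hsh : ShiftClosed L) (N p : ℕ) (hpN : p ≤ N)
    (hL : ∀ e ∈ L, e ⊆ Finset.Icc 1 N ∧ e.card = 2) (hM : ¬ HasM L (p + 1)) :
    ∃ q r : ℝ, 0 ≤ q ∧ 0 ≤ r ∧ q + r = p ∧ q * (q - 1) ≥ 0 ∧ (L.card : ℝ) ≤ q * N - q * (q + 1) / 2 + (2 * r + 1) * r := by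
  obtain ⟨q, hq, h⟩ := graph_structure L hsh N p hL hM
  refine ⟨q, (p - q : ℕ), by positivity, by positivity, by push_cast [hq]; ring, ?_, ?_⟩
  · rcases Nat.eq_zero_or_pos q with h | h
    · simp [h]
    · have : (1:ℝ) ≤ q := by exact_mod_cast h
      nlinarith
  have h' : (L.card : ℝ) + ((N - q).choose 2 : ℕ) ≤ (N.choose 2 : ℕ) + ((2 * (p - q) + 1).choose 2 : ℕ) := by exact_mod_cast h
  rw [choose_two_real, choose_two_real, choose_two_real] at h'
  rw [Nat.cast_sub (hq.trans hpN)] at h'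
  push_cast at h' ⊢
  set r : ℝ := ((p - q : ℕ) : ℝ)
  nlinarith

theorem graph_bound1 (L : Finset (Finset ℕ)) (hsh : ShiftClosed L) (N p : ℕ) (hpN : 2 * p + 1 ≤ N)
    (hL : ∀ e ∈ L, e ⊆ Finset.Icc 1 N ∧ e.card = 2) (hM : ¬ HasM L (p + 1)) :
    L.card ≤ p * N := by
  obtain ⟨q, r, hq, hr, hqr, _, h⟩ := graph_real L hsh N p (by omega) hL hM
  have : (L.card : ℝ) ≤ ((p * N : ℕ) : ℝ) := by
    push_cast
    have hN : 2 * (p : ℝ) + 1 ≤ N := by exact_mod_cast hpN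
    rw [← hqr] at hN ⊢
    nlinarith [mul_nonneg hq hr, mul_nonneg hr (by linarith : 0 ≤ (N:ℝ) - (2 * (q + r) + 1))]
  exact_mod_cast this

theorem graph_bound2 (L : Finset (Finset ℕ)) (hsh : ShiftClosed L) (s : ℕ) (hs : 15 ≤ s)
    (hL : ∀ e ∈ L, e ⊆ Finset.Icc 1 (3 * s + 2) ∧ e.card = 2) (hM : ¬ HasM L (s + 1)) :
    (L.card : ℝ) ≤ 13/5 * (s:ℝ)^2 := by
  obtain ⟨q, r, hq, hr, hqr, _, h⟩ := graph_real L hsh (3*s+2) s (by omega) hL hM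
  push_cast at h
  have hs' : (15:ℝ) ≤ s := by exact_mod_cast hs
  rw [← hqr] at h hs' ⊢
  nlinarith [mul_nonneg hq hr, sq_nonneg q, sq_nonneg r, mul_nonneg hq (by linarith : 0 ≤ q + r - 15), mul_nonneg hr (by linarith : 0 ≤ q + r - 15)]

/-- shifted under elementary shifts -/
def Shifted (F : Finset (Finset ℕ)) : Prop :=
  ∀ e ∈ F, ∀ i j, 1 ≤ i → i < j → j ∈ e → i ∉ e → insert i (e.erase j) ∈ F

theorem sum_replace (e : Finset ℕ) (i j : ℕ) (hij : i < j) (hj : j ∈ e) (hi : i ∉ e) :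
    ∑ v ∈ insert i (e.erase j), v < ∑ v ∈ e, v := by
  rw [sum_insert (by simp [hi]), ← Finset.add_sum_erase e (fun v => v) hj]
  omega

theorem Shifted.shiftClosed {F : Finset (Finset ℕ)} (h : Shifted F) : ShiftClosed F := by
  suffices H : ∀ m, ∀ e ∈ F, ∑ v ∈ e, v = m → ∀ φ : ℕ → ℕ, Set.InjOn φ e → (∀ v ∈ e, 1 ≤ φ v ∧ φ v ≤ v) → e.image φ ∈ F from
    fun e he φ h1 h2 => H _ e he rfl φ h1 h2
  intro m
  induction m using Nat.strong_induction_on with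
  | _ m ih =>
  intro e he hm φ hinj hφ
  by_cases hfix : ∀ v ∈ e, φ v = v
  · have : e.image φ = e := by
      rw [image_congr (g := id) (fun v hv => hfix v hv), image_id]
    rwa [this]
  · push Not at hfix
    have hex : ∃ v, v ∈ e ∧ φ v ≠ v := hfix
    let v := Nat.find hex
    obtain ⟨hv, hvne⟩ : v ∈ e ∧ φ v ≠ v := Nat.find_spec hex
    have hmin : ∀ u ∈ e, u < v → φ u = u := by
      intro u hu huv
      by_contra hne
      exact Nat.find_min hex huv ⟨hu, hne⟩
    have hlt : φ v < v := lt_of_le_of_ne (hφ v hv).2 hvne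
    have hnot : φ v ∉ e := by
      intro hmem
      have := hmin _ hmem hlt
      have := hinj hmem hv this
      omega
    have he1 := h e he (φ v) v (hφ v hv).1 hlt hv hnot
    have hsum := sum_replace e (φ v) v hlt hv hnot
    have himg : (insert (φ v) (e.erase v)).image (fun x => if x = φ v then φ v else φ x) = e.image φ := by
      rw [image_insert, if_pos rfl]
      have : (e.erase v).image (fun x => if x = φ v then φ v else φ x) = (e.erase v).image φ := by
        apply image_congr
        intro x hx
        have hx' : x ∈ e := mem_of_mem_erase hx
        have : x ≠ φ v := fun h => hnot (h ▸ hx')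
        simp [this]
      rw [this, ← image_insert, insert_erase hv]
    rw [← himg]
    refine ih _ (hm ▸ hsum) _ he1 rfl _ ?_ ?_
    · intro x hx y hy hxy
      have hx' : x = φ v ∨ (x ≠ v ∧ x ∈ e) := by simpa [and_comm] using hx
      have hy' : y = φ v ∨ (y ≠ v ∧ y ∈ e) := by simpa [and_comm] using hy
      simp only at hxy
      rcases hx' with rfl | ⟨hx1, hx2⟩ <;> rcases hy' with rfl | ⟨hy1, hy2⟩
      · rfl
      · have : y ≠ φ v := fun h => hnot (h ▸ hy2)
        rw [if_pos rfl, if_neg this] at hxy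
        exact absurd (hinj hv hy2 hxy).symm hy1
      · have : x ≠ φ v := fun h => hnot (h ▸ hx2)
        rw [if_pos rfl, if_neg this] at hxy
        exact absurd (hinj hx2 hv hxy) hx1
      · have h1 : y ≠ φ v := fun h => hnot (h ▸ hy2)
        have h2 : x ≠ φ v := fun h => hnot (h ▸ hx2)
        rw [if_neg h1, if_neg h2] at hxy
        exact hinj hx2 hy2 hxy
    · intro x hx
      have hx' : x = φ v ∨ (x ≠ v ∧ x ∈ e) := by simpa using hx
      rcases hx' with rfl | ⟨hx1, hx2⟩
      · rw [if_pos rfl]; exact ⟨(hφ v hv).1, le_rfl⟩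
      · have h2 : x ≠ φ v := fun h => hnot (h ▸ hx2)
        rw [if_neg h2]; exact hφ x hx2

/-- elementary shift map -/
def shMap (F : Finset (Finset ℕ)) (i j : ℕ) (e : Finset ℕ) : Finset ℕ :=
  if j ∈ e ∧ i ∉ e ∧ insert i (e.erase j) ∉ F then insert i (e.erase j) else e

theorem replace_back {e : Finset ℕ} {i j : ℕ} (hj : j ∈ e) (hi : i ∉ e) :
    insert j ((insert i (e.erase j)).erase i) = e := by
  rw [erase_insert (by simp [hi]), insert_erase hj]

theorem shMap_injOn (F : Finset (Finset ℕ)) (i j : ℕ) : Set.InjOn (shMap F i j) F := by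
  intro e he f hf h
  unfold shMap at h
  split_ifs at h with h1 h2 h2
  · rw [← replace_back h1.1 h1.2.1, ← replace_back h2.1 h2.2.1, h]
  · exact absurd (h ▸ hf) h1.2.2
  · exact absurd (h ▸ he) h2.2.2
  · exact h

theorem image_swap_replace {e : Finset ℕ} {i j : ℕ} (hj : j ∈ e) (hi : i ∉ e) :
    e.image (Equiv.swap i j) = insert i (e.erase j) := by
  ext x
  simp only [mem_image, mem_insert, mem_erase]
  constructor
  · rintro ⟨y, hy, rfl⟩
    by_cases hyj : y = j
    · left; rw [hyj, Equiv.swap_apply_right]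
    · have : y ≠ i := fun h => hi (h ▸ hy)
      right; rw [Equiv.swap_apply_of_ne_of_ne this hyj]; exact ⟨hyj, hy⟩
  · rintro (rfl | ⟨h1, h2⟩)
    · exact ⟨j, hj, Equiv.swap_apply_right _ _⟩
    · have : x ≠ i := fun h => hi (h ▸ h2)
      exact ⟨x, h2, Equiv.swap_apply_of_ne_of_ne this h1⟩

theorem image_swap_self {e : Finset ℕ} {i j : ℕ} (hj : j ∉ e) (hi : i ∉ e) :
    e.image (Equiv.swap i j) = e := by
  rw [image_congr (g := id), image_id]
  intro x hx
  exact Equiv.swap_apply_of_ne_of_ne (fun h => hi (h ▸ hx)) (fun h => hj (h ▸ hx))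

theorem shift_hasM (F : Finset (Finset ℕ)) (i j k : ℕ) (h : HasM (F.image (shMap F i j)) k) : HasM F k := by
  obtain ⟨g, hg, hd⟩ := h
  by_cases hall : ∀ a, g a ∈ F
  · exact ⟨g, hall, hd⟩
  push Not at hall
  obtain ⟨a, ha⟩ := hall
  have hkey : ∀ b, ∃ e ∈ F, shMap F i j e = g b := fun b => mem_image.1 (hg b)
  obtain ⟨e, he, hea⟩ := hkey a
  have hmv : (j ∈ e ∧ i ∉ e ∧ insert i (e.erase j) ∉ F) ∧ insert i (e.erase j) = g a := by
    unfold shMap at hea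
    split_ifs at hea with h1
    · exact ⟨h1, hea⟩
    · exact absurd (hea ▸ he) ha
  obtain ⟨⟨hj, hi, hn⟩, hga⟩ := hmv
  have hia : i ∈ g a := by rw [← hga]; simp
  refine ⟨fun b => (g b).image (Equiv.swap i j), ?_, ?_⟩
  · intro b
    show (g b).image (Equiv.swap i j) ∈ F
    by_cases hab : b = a
    · rw [hab, ← hga, ← image_swap_replace hj hi, image_image]
      have : (⇑(Equiv.swap i j) ∘ ⇑(Equiv.swap i j)) = id := by ext x; simp
      rw [this, image_id]; exact he
    · have hib : i ∉ g b := fun h => (disjoint_left.1 (hd a b (Ne.symm hab)) hia) h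
      obtain ⟨f, hf, hfb⟩ := hkey b
      unfold shMap at hfb
      split_ifs at hfb with h1
      · rw [← hfb] at hib; simp at hib
      · rw [← hfb] at hib ⊢
        by_cases hjb : j ∈ f
        · rw [image_swap_replace hjb hib]
          by_contra hcon
          exact h1 ⟨hjb, hib, hcon⟩
        · rw [image_swap_self hjb hib]; exact hf
  · intro b c hbc
    exact (disjoint_image (Equiv.injective _)).2 (hd b c hbc)

theorem exists_shifted (n r k : ℕ) (F : Finset (Finset ℕ)) (hF : ∀ e ∈ F, e ⊆ Icc 1 n ∧ e.card = r)
    (hM : ¬ HasM F k) : ∃ F' : Finset (Finset ℕ), (∀ e ∈ F', e ⊆ Icc 1 n ∧ e.card = r) ∧ F'.card = F.card ∧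
      ¬ HasM F' k ∧ ShiftClosed F' := by
  suffices H : ∀ m, ∀ F : Finset (Finset ℕ), ∑ e ∈ F, ∑ v ∈ e, v = m → (∀ e ∈ F, e ⊆ Icc 1 n ∧ e.card = r) →
    ¬ HasM F k → ∃ F' : Finset (Finset ℕ), (∀ e ∈ F', e ⊆ Icc 1 n ∧ e.card = r) ∧ F'.card = F.card ∧
      ¬ HasM F' k ∧ ShiftClosed F' from H _ F rfl hF hM
  clear hF hM F
  intro m
  induction m using Nat.strong_induction_on with
  | _ m ih =>
  intro F hm hF hM
  by_cases hsh : Shifted F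
  · exact ⟨F, hF, rfl, hM, hsh.shiftClosed⟩
  unfold Shifted at hsh
  push Not at hsh
  obtain ⟨e, he, i, j, hi1, hij, hje, hie, hne⟩ := hsh
  have hcard : (F.image (shMap F i j)).card = F.card := card_image_of_injOn (shMap_injOn F i j)
  have hw : ∑ e ∈ F.image (shMap F i j), ∑ v ∈ e, v < m := by
    rw [sum_image (shMap_injOn F i j), ← hm]
    apply sum_lt_sum
    · intro f hf
      unfold shMap
      split_ifs with h1
      · exact (sum_replace f i j hij h1.1 h1.2.1).le
      · exact le_rfl
    · refine ⟨e, he, ?_⟩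
      unfold shMap
      rw [if_pos ⟨hje, hie, hne⟩]
      exact sum_replace e i j hij hje hie
  obtain ⟨F', h1, h2, h3, h4⟩ := ih _ hw _ rfl (by
    intro f hf
    obtain ⟨f0, hf0, rfl⟩ := mem_image.1 hf
    unfold shMap
    split_ifs with h1
    · obtain ⟨h2, h3⟩ := hF f0 hf0
      refine ⟨?_, ?_⟩
      · intro x hx
        rcases mem_insert.1 hx with rfl | hx
        · have := h2 h1.1
          rw [mem_Icc] at this ⊢
          omega
        · exact h2 (mem_of_mem_erase hx)
      · rw [card_insert_of_notMem (by simp [h1.2.1]), card_erase_of_mem h1.1, h3]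
        have : 0 < f0.card := card_pos.2 ⟨j, h1.1⟩
        omega
    · exact hF f0 hf0) (fun h => hM (shift_hasM F i j k h))
  exact ⟨F', h1, h2.trans hcard, h3, h4⟩

/-- triples inside the first block -/
def KK (F : Finset (Finset ℕ)) (s : ℕ) : Finset (Finset ℕ) := F.filter (fun e => e ⊆ Icc 1 (3 * s + 2))
/-- link of the next vertex inside the first block -/
def LL (F : Finset (Finset ℕ)) (s : ℕ) : Finset (Finset ℕ) :=
  (powersetCard 2 (Icc 1 (3 * s + 2))).filter (fun e => insert (3 * s + 3) e ∈ F)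

theorem KK_shift {F : Finset (Finset ℕ)} (hF : ShiftClosed F) (s : ℕ) : ShiftClosed (KK F s) := by
  intro e he φ h1 h2
  rw [KK, mem_filter] at he ⊢
  refine ⟨hF e he.1 φ h1 h2, ?_⟩
  intro x hx
  obtain ⟨v, hv, rfl⟩ := mem_image.1 hx
  have := he.2 hv
  have := h2 v hv
  rw [mem_Icc] at *
  omega

theorem LL_shift {F : Finset (Finset ℕ)} (hF : ShiftClosed F) (s : ℕ) : ShiftClosed (LL F s) := by
  intro e he φ h1 h2
  rw [LL, mem_filter, mem_powersetCard] at he ⊢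
  obtain ⟨⟨he1, he2⟩, he3⟩ := he
  have hle : ∀ v ∈ e, v ≤ 3 * s + 2 := fun v hv => (mem_Icc.1 (he1 hv)).2
  refine ⟨⟨?_, ?_⟩, ?_⟩
  · intro x hx
    obtain ⟨v, hv, rfl⟩ := mem_image.1 hx
    have := hle v hv
    have := h2 v hv
    rw [mem_Icc]
    omega
  · rw [card_image_of_injOn h1, he2]
  · have := hF _ he3 (fun x => if x = 3 * s + 3 then 3 * s + 3 else φ x) (by
      intro x hx y hy hxy
      simp only [coe_insert, Set.mem_insert_iff, mem_coe] at hx hy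
      simp only at hxy
      rcases hx with rfl | hx <;> rcases hy with rfl | hy
      · rfl
      · have := hle y hy; have := h2 y hy
        rw [if_pos rfl, if_neg (by omega)] at hxy; omega
      · have := hle x hx; have := h2 x hx
        rw [if_pos rfl, if_neg (by omega)] at hxy; omega
      · have := hle y hy; have := hle x hx
        rw [if_neg (by omega), if_neg (by omega)] at hxy
        exact h1 hx hy hxy) (by
      intro v hv
      rcases mem_insert.1 hv with rfl | hv
      · rw [if_pos rfl]; omega
      · have := hle v hv
        rw [if_neg (by omega)]; exact h2 v hv)
    rw [image_insert, if_pos rfl] at this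
    rw [image_congr (g := φ)] at this
    · exact this
    · intro x hx
      have := hle x hx
      simp only
      rw [if_neg (by omega)]

theorem EE_noM {F : Finset (Finset ℕ)} (hF : ShiftClosed F) (h3 : ∀ e ∈ F, e.card = 3) (s : ℕ)
    (hM : ¬ HasM F (s + 1)) : ¬ HasM (KK F s ∪ LL F s) (s + 1) := by
  classical
  rintro ⟨g, hg, hd⟩
  apply hM
  have hsub : ∀ i, g i ⊆ Icc 1 (3 * s + 2) := by
    intro i
    rcases mem_union.1 (hg i) with h | h
    · exact (mem_filter.1 h).2
    · exact (mem_powersetCard.1 (mem_filter.1 h).1).1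
  let T : Finset (Fin (s+1)) := univ.filter (fun i => g i ∈ LL F s)
  have hc2 : ∀ i ∈ T, (g i).card = 2 := fun i hi =>
    (mem_powersetCard.1 (mem_filter.1 (mem_filter.1 hi).2).1).2
  have hc3 : ∀ i, i ∉ T → g i ∈ F := by
    intro i hi
    rcases mem_union.1 (hg i) with h | h
    · exact (mem_filter.1 h).1
    · exact absurd (show i ∈ T by simp only [T, mem_filter, mem_univ, true_and]; exact h) hi
  let U := univ.biUnion g
  have hU : U.card + T.card = 3 * s + 3 := by
    have h1 : U.card = ∑ i, (g i).card := card_biUnion (fun i _ j _ hij => hd i j hij)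
    have h2 : T.card = ∑ i, (if i ∈ T then 1 else 0) := by simp
    rw [h1, h2, ← sum_add_distrib]
    have : ∀ i ∈ (univ : Finset (Fin (s+1))), (g i).card + (if i ∈ T then 1 else 0) = 3 := by
      intro i _
      by_cases hi : i ∈ T
      · rw [if_pos hi, hc2 i hi]
      · rw [if_neg hi, h3 _ (hc3 i hi)]
    rw [sum_congr rfl this]
    simp; ring
  have hUsub : U ⊆ Icc 1 (3 * s + 2) := by
    intro x hx
    obtain ⟨i, _, hi⟩ := mem_biUnion.1 hx
    exact hsub i hi
  have hR : (Icc 1 (3 * s + 3) \ U).card = T.card := by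
    rw [card_sdiff_of_subset (hUsub.trans (Icc_subset_Icc le_rfl (by omega)))]
    simp; omega
  let ε : T ≃ (Icc 1 (3 * s + 3) \ U : Finset ℕ) := (Finset.equivOfCardEq hR).symm
  let g' : Fin (s+1) → Finset ℕ := fun i => if h : i ∈ T then insert (ε ⟨i, h⟩).1 (g i) else g i
  have hε : ∀ i (h : i ∈ T), ((ε ⟨i, h⟩).1 ∈ Icc 1 (3 * s + 3)) ∧ (ε ⟨i, h⟩).1 ∉ U := fun i h =>
    mem_sdiff.1 (ε ⟨i, h⟩).2
  have hgU : ∀ i x, x ∈ g i → x ∈ U := fun i x hx => mem_biUnion.2 ⟨i, mem_univ _, hx⟩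
  refine ⟨g', ?_, ?_⟩
  · intro i
    by_cases hi : i ∈ T
    · simp only [g', hi, dif_pos]
      obtain ⟨hc1, hcU⟩ := hε i hi
      set c := (ε ⟨i, hi⟩).1
      have hmem := (mem_filter.1 (mem_filter.1 hi).2).2
      have hle : ∀ v ∈ g i, 1 ≤ v ∧ v ≤ 3 * s + 2 := fun v hv => mem_Icc.1 (hsub i hv)
      have := hF _ hmem (fun x => if x = 3 * s + 3 then c else x) (by
        intro x hx y hy hxy
        simp only [coe_insert, Set.mem_insert_iff, mem_coe] at hx hy
        simp only at hxy
        rcases hx with rfl | hx <;> rcases hy with rfl | hy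
        · rfl
        · have := hle y hy
          rw [if_pos rfl, if_neg (by omega)] at hxy
          exact absurd (hgU i y hy) (hxy ▸ hcU)
        · have := hle x hx
          rw [if_pos rfl, if_neg (by omega)] at hxy
          exact absurd (hgU i x hx) (hxy ▸ hcU)
        · have := hle y hy; have := hle x hx
          rw [if_neg (by omega), if_neg (by omega)] at hxy
          exact hxy) (by
        intro v hv
        rcases mem_insert.1 hv with rfl | hv
        · rw [if_pos rfl]; exact mem_Icc.1 hc1
        · have := hle v hv
          rw [if_neg (by omega)]; omega)
      rw [image_insert, if_pos rfl, image_congr (g := id), image_id] at this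
      · exact this
      · intro x hx
        have := hle x hx
        simp only
        rw [if_neg (by omega)]; rfl
    · simp only [g', hi, dif_neg, not_false_eq_true]
      exact hc3 i hi
  · intro i j hij
    have hdij := disjoint_left.1 (hd i j hij)
    rw [disjoint_left]
    intro x hx hy
    by_cases hi : i ∈ T <;> by_cases hj : j ∈ T
    · simp only [g', hi, hj, dif_pos, mem_insert] at hx hy
      rcases hx with rfl | hx <;> rcases hy with hy | hy
      · have := ε.injective (Subtype.ext hy)
        simp at this
        exact hij this
      · exact (hε i hi).2 (hgU j _ hy)
      · exact (hε j hj).2 (hy ▸ hgU i _ hx)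
      · exact hdij hx hy
    · simp only [g', hi, hj, dif_pos, dif_neg, mem_insert, not_false_eq_true] at hx hy
      rcases hx with rfl | hx
      · exact (hε i hi).2 (hgU j _ hy)
      · exact hdij hx hy
    · simp only [g', hi, hj, dif_pos, dif_neg, mem_insert, not_false_eq_true] at hx hy
      rcases hy with rfl | hy
      · exact (hε j hj).2 (hgU i _ hx)
      · exact hdij hx hy
    · simp only [g', hi, hj, dif_neg, not_false_eq_true] at hx hy
      exact hdij hx hy

theorem F_card_le {F : Finset (Finset ℕ)} (hF : ShiftClosed F) (n s : ℕ) (h3 : ∀ e ∈ F, e ⊆ Icc 1 n ∧ e.card = 3)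
    (hn : ({1, 3 * s + 2, 3 * s + 3} : Finset ℕ) ∉ F) :
    F.card ≤ (KK F s).card + (n - (3 * s + 2)) * (LL F s).card := by
  classical
  have hsub : F ⊆ KK F s ∪ ((Icc (3 * s + 3) n) ×ˢ (LL F s)).image (fun p => insert p.1 p.2) := by
    intro e he
    rw [mem_union]
    by_cases hK : e ⊆ Icc 1 (3 * s + 2)
    · left; exact mem_filter.2 ⟨he, hK⟩
    right
    obtain ⟨hen, hec⟩ := h3 e he
    have hne : e.Nonempty := card_pos.1 (by omega)
    set z := e.max' hne with hz
    have hze : z ∈ e := e.max'_mem hne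
    have hmax : ∀ x ∈ e, x ≤ z := fun x hx => e.le_max' x hx
    have hzn := mem_Icc.1 (hen hze)
    have hzge : 3 * s + 3 ≤ z := by
      by_contra hlt
      apply hK
      intro x hx
      have := hmax x hx
      have := mem_Icc.1 (hen hx)
      rw [mem_Icc]; omega
    have hc2 : (e.erase z).card = 2 := by rw [card_erase_of_mem hze, hec]
    have hrest : ∀ y ∈ e.erase z, y ≤ 3 * s + 1 := by
      intro y hy
      by_contra hlt
      apply hn
      have hyz : y ≠ z := (mem_erase.1 hy).1
      have hye : y ∈ e := (mem_erase.1 hy).2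
      have hyz' := hmax y hye
      have hc1 : ((e.erase z).erase y).card = 1 := by rw [card_erase_of_mem hy, hc2]
      obtain ⟨x, hx⟩ := card_eq_one.1 hc1
      have hxm : x ∈ ((e.erase z).erase y) := by rw [hx]; simp
      have hxy : x ≠ y := (mem_erase.1 hxm).1
      have hxz : x ≠ z := (mem_erase.1 (mem_erase.1 hxm).2).1
      have hxe : x ∈ e := (mem_erase.1 (mem_erase.1 hxm).2).2
      have he3 : e = {x, y, z} := by
        rw [← insert_erase hze, ← insert_erase hy, hx]
        ext w; simp; tauto
      have h1 := mem_Icc.1 (hen hxe)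
      have := hF e he (fun w => if w = x then 1 else if w = y then 3 * s + 2 else 3 * s + 3) (by
        intro a ha b hb hab
        rw [he3] at ha hb
        simp only [coe_insert, coe_singleton, Set.mem_insert_iff, Set.mem_singleton_iff] at ha hb
        simp only at hab
        split_ifs at hab <;> omega) (by
        intro v hv
        rw [he3] at hv
        simp only [mem_insert, mem_singleton] at hv
        split_ifs <;> omega)
      rw [he3, image_insert, image_insert, image_singleton, if_pos rfl, if_neg hxy.symm, if_pos rfl, if_neg hxz.symm, if_neg (Ne.symm hyz)] at this
      exact this
    rw [mem_image]
    refine ⟨(z, e.erase z), ?_, insert_erase hze⟩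
    rw [mem_product, mem_Icc]
    refine ⟨⟨hzge, hzn.2⟩, mem_filter.2 ⟨mem_powersetCard.2 ⟨?_, hc2⟩, ?_⟩⟩
    · intro y hy
      have := hrest y hy
      have := mem_Icc.1 (hen (mem_erase.1 hy).2)
      rw [mem_Icc]; omega
    · have := hF e he (fun w => if w = z then 3 * s + 3 else w) (by
        intro a ha b hb hab
        simp only at hab
        by_cases h1 : a = z <;> by_cases h2 : b = z
        · rw [h1, h2]
        · have := hrest b (mem_erase.2 ⟨h2, hb⟩)
          rw [if_pos h1, if_neg h2] at hab; omega
        · have := hrest a (mem_erase.2 ⟨h1, ha⟩)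
          rw [if_pos h2, if_neg h1] at hab; omega
        · rwa [if_neg h1, if_neg h2] at hab) (by
        intro v hv
        have := mem_Icc.1 (hen hv)
        split_ifs <;> omega)
      rw [← insert_erase hze, image_insert, if_pos rfl, image_congr (g := id), image_id] at this
      · exact this
      · intro x hx
        have : x ≠ z := (mem_erase.1 hx).1
        simp [this]
  refine (card_le_card hsub).trans ((card_union_le _ _).trans ?_)
  apply Nat.add_le_add_left
  refine card_image_le.trans ?_
  rw [card_product, Nat.card_Icc]
  apply Nat.mul_le_mul_right
  omega

theorem LL_spec {F : Finset (Finset ℕ)} {s : ℕ} : ∀ e ∈ LL F s, e ⊆ Icc 1 (3 * s + 2) ∧ e.card = 2 :=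
  fun _ he => mem_powersetCard.1 (mem_filter.1 he).1

theorem HasM.mono {E F : Finset (Finset ℕ)} (h : E ⊆ F) {k : ℕ} (hE : HasM E k) : HasM F k := by
  obtain ⟨g, h1, h2⟩ := hE
  exact ⟨g, fun i => h (h1 i), h2⟩

/-- missing triples -/
def miss (F : Finset (Finset ℕ)) (s : ℕ) : ℕ :=
  ((powersetCard 3 (Icc 1 (3 * s + 2))).filter (fun e => e ∉ KK F s)).card

theorem miss_add {F : Finset (Finset ℕ)} {s : ℕ} (h3 : ∀ e ∈ F, e.card = 3) :
    miss F s + (KK F s).card = (3 * s + 2).choose 3 := by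
  have h1 := Finset.card_filter_add_card_filter_not (s := powersetCard 3 (Icc 1 (3 * s + 2))) (fun e => e ∈ KK F s)
  rw [card_powersetCard, Nat.card_Icc] at h1
  have h2 : (powersetCard 3 (Icc 1 (3 * s + 2))).filter (fun e => e ∈ KK F s) = KK F s := by
    ext e
    simp only [mem_filter, mem_powersetCard]
    constructor
    · exact fun h => h.2
    · intro h
      have := mem_filter.1 h
      exact ⟨⟨this.2, h3 e this.1⟩, h⟩
  rw [h2] at h1
  unfold miss
  simp only [Nat.add_sub_cancel] at h1
  omega

theorem main_B {F : Finset (Finset ℕ)} (hF : ShiftClosed F) (h3 : ∀ e ∈ F, e.card = 3) (s G : ℕ)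
    (hM : ¬ HasM F (s + 1)) (hG : 1000000 ≤ G) (hs : 1000000 * (4 ^ G + 10) ≤ s)
    (hL : (s:ℝ)^2 / 50 ≤ (LL F s).card) :
    39 / 80 * (s:ℝ) * (LL F s).card ≤ miss F s := by
  set N := 3 * s + 2 with hN
  set B := N / G + 1 with hB
  have hE := EE_noM hF h3 s hM
  have hEs : ShiftClosed (KK F s ∪ LL F s) := by
    intro e he φ h1 h2
    rcases mem_union.1 he with h | h
    · exact mem_union_left _ (KK_shift hF s e h φ h1 h2)
    · exact mem_union_right _ (LL_shift hF s e h φ h1 h2)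
  have hNB : N < G * B := by
    have h1 := Nat.div_add_mod N G
    have h2 := Nat.mod_lt N (show G > 0 by omega)
    rw [hB, mul_add]; omega
  obtain ⟨W, hW0, hW1, hWE, hWs⟩ := exists_cover (KK F s ∪ LL F s) hEs (by
    intro e he
    rcases mem_union.1 he with h | h
    · exact (h3 e (mem_filter.1 h).1).le
    · rw [(LL_spec e h).2]; omega) N G s B (by omega) (Nat.succ_pos _) hNB (by
    intro e he
    rcases mem_union.1 he with h | h
    · exact (mem_filter.1 h).2
    · exact (LL_spec e h).1) hE
  have hBle : (B:ℝ) ≤ N / 1000000 + 1 := by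
    rw [hB]; push_cast
    have h1 : ((N / G : ℕ) : ℝ) ≤ (N : ℝ) / G := Nat.cast_div_le
    have h2 : (N : ℝ) / G ≤ N / 1000000 := by
      apply div_le_div_of_nonneg_left (by positivity) (by norm_num)
      exact_mod_cast hG
    linarith
  have hs' : 1000000 * ((4:ℝ) ^ G + 10) ≤ s := by exact_mod_cast hs
  have hX : (0:ℝ) ≤ 4 ^ G := by positivity
  have hWs' : ∑ v ∈ Icc 1 N, W v ≤ (s:ℝ) + 1 + B + 4 ^ G := by
    refine hWs.trans (le_of_eq ?_)
    push_cast; ring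
  generalize (4:ℝ) ^ G = X at *
  have hNr : (N:ℝ) = 3 * s + 2 := by rw [hN]; push_cast; ring
  have hcard : ((Icc 1 N).card : ℝ) = N := by simp
  have hc := cover_ineq (Icc 1 N) W (KK F s) (LL F s) (s / 200000) (by positivity) hW0 hW1
    (fun e he => hWE e (mem_union_left _ he)) LL_spec (fun e he => hWE e (mem_union_right _ he)) (by
      rw [hcard]
      rw [hNr] at hBle ⊢
      linarith)
  rw [hcard] at hc
  have hmiss : ((((Icc 1 N).powersetCard 3).filter (fun e => e ∉ KK F s)).card : ℝ) = miss F s := rfl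
  rw [hmiss, hNr] at hc
  generalize ((LL F s).card : ℝ) = l at *
  generalize (miss F s : ℝ) = M at *
  have hs7 : (10000000 : ℝ) ≤ s := by linarith
  generalize (s:ℝ) = t at *
  have e1 : 3 * (3 * t + 2)^2 + 5 * (t / 200000) * (3 * t + 2)^2 ≤ 15/1000 * t * (t^2/50) := by
    nlinarith [mul_nonneg (by linarith : (0:ℝ) ≤ t - 10000000) (sq_nonneg t), sq_nonneg t]
  have e2 : 15/1000 * t * (t^2/50) ≤ 15/1000 * t * l := mul_le_mul_of_nonneg_left hL (by linarith)
  have hl : 0 ≤ l := le_trans (by positivity) hL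
  nlinarith [mul_nonneg hl (by linarith : (0:ℝ) ≤ t)]

theorem main_A {F : Finset (Finset ℕ)} (hF : ShiftClosed F) (h3 : ∀ e ∈ F, e.card = 3) (s : ℕ)
    (hM : ¬ HasM F (s + 1)) (hs : 1000 ≤ s)
    (hL : ((LL F s).card : ℝ) ≤ (s:ℝ)^2 / 50) :
    39 / 80 * (s:ℝ) * (LL F s).card ≤ miss F s := by
  classical
  rcases Nat.eq_zero_or_pos (LL F s).card with h0 | h0
  · rw [h0]; simp
  have hE := EE_noM hF h3 s hM
  set N := 3 * s + 2 with hN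
  obtain ⟨p0, hp0, hp1⟩ : ∃ p0, p0 * N < (LL F s).card ∧ (LL F s).card ≤ (p0 + 1) * N := by
    refine ⟨((LL F s).card - 1) / N, ?_, ?_⟩
    · have := Nat.div_mul_le_self ((LL F s).card - 1) N
      omega
    · have := Nat.lt_div_mul_add (a := (LL F s).card - 1) (b := N) (by omega)
      rw [add_mul, one_mul]
      omega
  have hs' : (1000:ℝ) ≤ s := by exact_mod_cast hs
  have hNr : (N:ℝ) = 3 * s + 2 := by rw [hN]; push_cast; ring
  have hp0r : (p0:ℝ) ≤ s / 150 := by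
    have h1 : (p0:ℝ) * N < (LL F s).card := by exact_mod_cast hp0
    rw [hNr] at h1
    by_contra hcon
    push Not at hcon
    nlinarith
  have hp0n : 150 * p0 ≤ s := by
    have : 150 * (p0:ℝ) ≤ s := by linarith
    exact_mod_cast this
  have hLM : HasM (LL F s) (p0 + 1) := by
    by_contra hcon
    have := graph_bound1 (LL F s) (LL_shift hF s) N p0 (by omega) LL_spec hcon
    omega
  obtain ⟨p, hp⟩ : ∃ p, p = p0 + 1 := ⟨_, rfl⟩
  rw [← hp] at hLM hp1
  obtain ⟨g, hg, hgd⟩ := hLM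
  let U := univ.biUnion g
  have hU : U.card = 2 * p := by
    have h1 : U.card = ∑ i, (g i).card := card_biUnion (fun i _ j _ hij => hgd i j hij)
    rw [h1, sum_congr rfl (fun i _ => (LL_spec _ (hg i)).2)]
    simp; ring
  have hUs : U ⊆ Icc 1 N := by
    intro x hx
    obtain ⟨i, _, hi⟩ := mem_biUnion.1 hx
    exact (LL_spec _ (hg i)).1 hi
  let A := Icc 1 N \ U
  have hA : A.card = N - 2 * p := by
    simp only [A]
    rw [card_sdiff_of_subset hUs, hU]; simp
  let K' := (KK F s).filter (fun e => e ⊆ A)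
  have hK' : ¬ HasM K' (s - p + 1) := by
    rintro ⟨k, hk, hkd⟩
    apply hE
    refine hasM_of_card _ (univ : Finset (Fin p ⊕ Fin (s - p + 1))) (Sum.elim g k) (s+1) ?_ ?_ ?_
    · simp; omega
    · rintro (i | i) _
      · exact mem_union_right _ (hg i)
      · exact mem_union_left _ (mem_filter.1 (hk i)).1
    · have hcross : ∀ i j, Disjoint (g i) (k j) := by
        intro i j
        rw [disjoint_left]
        intro x hx hy
        have := (mem_filter.1 (hk j)).2 hy
        exact (mem_sdiff.1 this).2 (mem_biUnion.2 ⟨i, mem_univ _, hx⟩)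
      rintro (i | i) _ (j | j) _ hij
      · exact hgd i j (fun h => hij (by rw [h]))
      · exact hcross i j
      · exact (hcross j i).symm
      · exact hkd i j (fun h => hij (by rw [h]))
  have hav := averaging A K' (A.card / 3) (s - p) 3 (by
    intro e he
    exact ⟨(mem_filter.1 he).2, h3 e (mem_filter.1 (mem_filter.1 he).1).1⟩) (Nat.mul_div_le _ _) hK'
  have hmiss : A.card.choose 3 ≤ miss F s + K'.card := by
    rw [← card_powersetCard]
    have : powersetCard 3 A ⊆ ((powersetCard 3 (Icc 1 N)).filter (fun e => e ∉ KK F s)) ∪ K' := by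
      intro e he
      obtain ⟨h1, h2⟩ := mem_powersetCard.1 he
      by_cases hk : e ∈ KK F s
      · exact mem_union_right _ (mem_filter.2 ⟨hk, h1⟩)
      · exact mem_union_left _ (mem_filter.2 ⟨mem_powersetCard.2 ⟨h1.trans sdiff_subset, h2⟩, hk⟩)
    exact (card_le_card this).trans (card_union_le _ _)
  have hLp : ((LL F s).card : ℝ) ≤ p * (3 * s + 2) := by
    rw [← hNr]; exact_mod_cast hp1
  have hq : (3 * (s:ℝ) - 2 * p) ≤ 3 * ((A.card / 3 : ℕ) : ℝ) := by
    have : 3 * s ≤ 3 * (A.card / 3) + 2 * p := by omega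
    have : 3 * (s:ℝ) ≤ 3 * ((A.card / 3 : ℕ) : ℝ) + 2 * p := by exact_mod_cast this
    linarith
  have hav' : ((A.card / 3 : ℕ) : ℝ) * K'.card ≤ ((s:ℝ) - p) * (A.card.choose 3 : ℕ) := by
    rw [← Nat.cast_sub (by omega : p ≤ s)]
    exact_mod_cast hav
  have hAr : (A.card : ℝ) = 3 * s + 2 - 2 * p := by
    rw [hA, Nat.cast_sub (by omega), hNr]; push_cast; ring
  have hmr : ((A.card.choose 3 : ℕ) : ℝ) ≤ miss F s + K'.card := by exact_mod_cast hmiss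
  have hpr : (p:ℝ) ≤ s / 150 + 1 := by rw [hp]; push_cast; linarith
  have hp1r : (1:ℝ) ≤ p := by rw [hp]; push_cast; linarith [(Nat.cast_nonneg p0 : (0:ℝ) ≤ p0)]
  have hC : (3 * (s:ℝ) - 2 * p)^3 / 6 ≤ ((A.card.choose 3 : ℕ) : ℝ) := by
    rw [choose_three_real, hAr]
    have hx : (0:ℝ) ≤ 3 * s - 2 * p := by linarith
    have : 3 * (s:ℝ) + 2 - 2 * p = (3 * s - 2 * p) + 2 := by ring
    rw [this]
    generalize 3 * (s:ℝ) - 2 * p = x at *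
    nlinarith [mul_nonneg hx hx]
  generalize ((A.card / 3 : ℕ) : ℝ) = q at *
  generalize ((A.card.choose 3 : ℕ) : ℝ) = C at *
  have hkn : (0:ℝ) ≤ K'.card := Nat.cast_nonneg _
  generalize (K'.card : ℝ) = k at *
  have hmn : (0:ℝ) ≤ miss F s := Nat.cast_nonneg _
  generalize (miss F s : ℝ) = M at *
  generalize ((LL F s).card : ℝ) = l at *
  generalize (p:ℝ) = p at *
  generalize (s:ℝ) = t at *
  have hx : 0 < 3 * t - 2 * p := by linarith
  have h1 : (3 * t - 2 * p) * k ≤ 3 * (t - p) * C := by nlinarith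
  have h2 : (3 * t - 2 * p) * M ≥ p * C := by nlinarith
  have h3 : (3 * t - 2 * p) * M ≥ (3 * t - 2 * p) * (p * (3 * t - 2 * p)^2 / 6) := by
    nlinarith [mul_le_mul_of_nonneg_left hC (by linarith : 0 ≤ p)]
  have h4 : p * (3 * t - 2 * p)^2 / 6 ≤ M := le_of_mul_le_mul_left h3 hx
  have h5 : 39/80 * t * (3 * t + 2) ≤ (3 * t - 2 * p)^2 / 6 := by
    have : (448/150 * t - 2)^2 ≤ (3 * t - 2 * p)^2 := by
      apply pow_le_pow_left₀ <;> linarith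
    nlinarith
  have h6 : p * (39/80 * t * (3 * t + 2)) ≤ p * ((3 * t - 2 * p)^2 / 6) := mul_le_mul_of_nonneg_left h5 (by linarith)
  have h7 : 39/80 * t * l ≤ 39/80 * t * (p * (3 * t + 2)) := mul_le_mul_of_nonneg_left hLp (by linarith)
  linarith

theorem main_lemma {F : Finset (Finset ℕ)} (hF : ShiftClosed F) (h3 : ∀ e ∈ F, e.card = 3) (s G : ℕ)
    (hM : ¬ HasM F (s + 1)) (hG : 1000000 ≤ G) (hs : 1000000 * (4 ^ G + 10) ≤ s) :
    39 / 80 * (s:ℝ) * (LL F s).card ≤ miss F s := by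
  rcases le_total ((s:ℝ)^2 / 50) ((LL F s).card : ℝ) with h | h
  · exact main_B hF h3 s G hM hG hs h
  · refine main_A hF h3 s hM ?_ h
    generalize 4 ^ G = X at hs
    omega

theorem step_noM {F : Finset (Finset ℕ)} (hF : ShiftClosed F) (n s : ℕ) (h3 : ∀ e ∈ F, e ⊆ Icc 1 n ∧ e.card = 3)
    (hmem : ({1, 3 * s + 2, 3 * s + 3} : Finset ℕ) ∈ F) (hM : ¬ HasM F (s + 1)) :
    ¬ HasM (F.filter (fun e => 1 ∉ e)) s := by
  classical
  rintro ⟨g, hg, hd⟩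
  apply hM
  have hgF : ∀ i, g i ∈ F := fun i => (mem_filter.1 (hg i)).1
  have hg1 : ∀ i, 1 ∉ g i := fun i => (mem_filter.1 (hg i)).2
  let U := univ.biUnion g
  have hU : U.card = 3 * s := by
    have h1 : U.card = ∑ i, (g i).card := card_biUnion (fun i _ j _ hij => hd i j hij)
    rw [h1, sum_congr rfl (fun i _ => (h3 _ (hgF i)).2)]
    simp; ring
  have hU2 : ∀ x ∈ U, 2 ≤ x := by
    intro x hx
    obtain ⟨i, _, hi⟩ := mem_biUnion.1 hx
    have := mem_Icc.1 ((h3 _ (hgF i)).1 hi)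
    have : x ≠ 1 := fun h => hg1 i (h ▸ hi)
    omega
  have hgU : ∀ i x, x ∈ g i → x ∈ U := fun i x hx => mem_biUnion.2 ⟨i, mem_univ _, hx⟩
  let φ : ℕ → ℕ := fun v => (U.filter (fun u => u < v)).card + 2
  have hmono : ∀ x ∈ U, ∀ y ∈ U, x < y → φ x < φ y := by
    intro x hx y hy hxy
    apply Nat.add_lt_add_right
    apply card_lt_card
    refine ⟨?_, ?_⟩
    · intro u hu
      rw [mem_filter] at hu ⊢
      exact ⟨hu.1, hu.2.trans hxy⟩
    · intro hsub
      have := hsub (mem_filter.2 ⟨hx, hxy⟩)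
      rw [mem_filter] at this
      omega
  have hinj : ∀ x ∈ U, ∀ y ∈ U, φ x = φ y → x = y := by
    intro x hx y hy h
    rcases lt_trichotomy x y with h1 | h1 | h1
    · have := hmono x hx y hy h1; omega
    · exact h1
    · have := hmono y hy x hx h1; omega
  have hle : ∀ x ∈ U, φ x ≤ x := by
    intro x hx
    have h1 : (U.filter (fun u => u < x)) ⊆ Ico 2 x := by
      intro u hu
      rw [mem_filter] at hu
      rw [mem_Ico]; exact ⟨hU2 u hu.1, hu.2⟩
    have := card_le_card h1
    rw [Nat.card_Ico] at this
    have := hU2 x hx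
    simp only [φ]; omega
  have hlt : ∀ x ∈ U, φ x < 3 * s + 2 := by
    intro x hx
    have h1 : (U.filter (fun u => u < x)) ⊂ U := by
      refine ⟨filter_subset _ _, fun h => ?_⟩
      have := mem_filter.1 (h hx)
      omega
    have := card_lt_card h1
    simp only [φ]; omega
  have hge : ∀ x, 2 ≤ φ x := fun x => by simp [φ]
  refine hasM_of_card F (univ : Finset (Option (Fin s)))
    (fun o => o.elim {1, 3 * s + 2, 3 * s + 3} (fun i => (g i).image φ)) (s+1) (by simp) ?_ ?_
  · rintro (_ | i) _
    · exact hmem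
    · apply hF _ (hgF i)
      · intro x hx y hy h
        exact hinj x (hgU i x hx) y (hgU i y hy) h
      · intro v hv
        exact ⟨by have := hge v; omega, hle v (hgU i v hv)⟩
  · have hcross : ∀ i, Disjoint ({1, 3 * s + 2, 3 * s + 3} : Finset ℕ) ((g i).image φ) := by
      intro i
      rw [disjoint_left]
      intro x hx hy
      obtain ⟨v, hv, rfl⟩ := mem_image.1 hy
      have := hge v
      have := hlt v (hgU i v hv)
      simp only [mem_insert, mem_singleton] at hx
      omega
    rintro (_ | i) _ (_ | j) _ hij
    · exact absurd rfl hij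
    · exact hcross j
    · exact (hcross i).symm
    · have hij' : i ≠ j := fun h => hij (by rw [h])
      show Disjoint ((g i).image φ) ((g j).image φ)
      rw [disjoint_left]
      intro x hx hy
      obtain ⟨v, hv, rfl⟩ := mem_image.1 hx
      obtain ⟨w, hw, h⟩ := mem_image.1 hy
      have := hinj w (hgU j w hw) v (hgU i v hv) h
      subst this
      exact disjoint_left.1 (hd i j hij') hv hw

theorem move_down (F : Finset (Finset ℕ)) (n k : ℕ) (h3 : ∀ e ∈ F, e ⊆ Icc 1 n ∧ e.card = 3) (h1 : ∀ e ∈ F, 1 ∉ e)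
    (hM : ¬ HasM F k) : ∃ F' : Finset (Finset ℕ), (∀ e ∈ F', e ⊆ Icc 1 (n - 1) ∧ e.card = 3) ∧ F'.card = F.card ∧
      ¬ HasM F' k := by
  classical
  have hinv : ∀ e ∈ F, (e.image (fun x => x - 1)).image (fun x => x + 1) = e := by
    intro e he
    rw [image_image, image_congr (g := id), image_id]
    intro x hx
    have := mem_Icc.1 ((h3 e he).1 hx)
    simp; omega
  refine ⟨F.image (fun e => e.image (fun x => x - 1)), ?_, ?_, ?_⟩
  · intro f hf
    obtain ⟨e, he, rfl⟩ := mem_image.1 hf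
    refine ⟨?_, ?_⟩
    · intro y hy
      obtain ⟨x, hx, rfl⟩ := mem_image.1 hy
      have h2 := mem_Icc.1 ((h3 e he).1 hx)
      have : x ≠ 1 := fun h => h1 e he (h ▸ hx)
      rw [mem_Icc]; omega
    · rw [card_image_of_injOn, (h3 e he).2]
      intro x hx y hy h
      have h2 := mem_Icc.1 ((h3 e he).1 hx)
      have h4 := mem_Icc.1 ((h3 e he).1 hy)
      simp only at h; omega
  · apply card_image_of_injOn
    intro e he f hf h
    simp only at h
    rw [← hinv e he, h, hinv f hf]
  · rintro ⟨g, hg, hd⟩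
    apply hM
    refine ⟨fun i => (g i).image (fun x => x + 1), ?_, ?_⟩
    · intro i
      obtain ⟨e, he, h⟩ := mem_image.1 (hg i)
      simp only
      rw [← h, hinv e he]; exact he
    · intro i j hij
      exact (disjoint_image (add_left_injective 1)).2 (hd i j hij)

theorem deg_one (F : Finset (Finset ℕ)) (n : ℕ) (h3 : ∀ e ∈ F, e ⊆ Icc 1 n ∧ e.card = 3) :
    F.card ≤ (n - 1).choose 2 + (F.filter (fun e => 1 ∉ e)).card := by
  have h := Finset.card_filter_add_card_filter_not (s := F) (fun e => 1 ∈ e)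
  have h2 : (F.filter (fun e => 1 ∈ e)).card ≤ (powersetCard 2 (Icc 2 n)).card := by
    apply card_le_card_of_injOn (fun e => e.erase 1)
    · intro e he
      rw [mem_coe, mem_filter] at he
      rw [mem_coe, mem_powersetCard]
      refine ⟨?_, ?_⟩
      · intro x hx
        have hx' := mem_erase.1 hx
        have := mem_Icc.1 ((h3 e he.1).1 hx'.2)
        rw [mem_Icc]; omega
      · rw [card_erase_of_mem he.2, (h3 e he.1).2]
    · intro e he f hf h
      rw [mem_coe, mem_filter] at he hf
      simp only at h
      rw [← insert_erase he.2, h, insert_erase hf.2]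
  rw [card_powersetCard, Nat.card_Icc] at h2
  have : n + 1 - 2 = n - 1 := by omega
  rw [this] at h2
  omega

theorem star_real (n s : ℕ) (h : s ≤ n) :
    (((n.choose 3 - (n - s).choose 3 : ℕ)) : ℝ) = s * (3 * n^2 - 3 * n * s + s^2 - 6 * n + 3 * s + 2) / 6 := by
  rw [Nat.cast_sub (Nat.choose_le_choose 3 (by omega)), choose_three_real, choose_three_real, Nat.cast_sub h]
  ring

theorem step_arith (n s : ℕ) (hn : 3 * (s + 1) + 3 ≤ n) :
    (n - 1).choose 2 + max ((n - 1).choose 3 - (n - 1 - s).choose 3) ((3 * s + 2).choose 3) ≤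
    max (n.choose 3 - (n - (s + 1)).choose 3) ((3 * (s + 1) + 2).choose 3) := by
  obtain ⟨k, rfl⟩ : ∃ k, n = k + 1 := ⟨n - 1, by omega⟩
  have e0 : k + 1 - 1 = k := by omega
  have e1 : k + 1 - (s + 1) = k - s := by omega
  rw [e0, e1]
  have hP : (k + 1).choose 3 = k.choose 2 + k.choose 3 := Nat.choose_succ_succ k 2
  have hmono : (k - s).choose 3 ≤ k.choose 3 := Nat.choose_le_choose 3 (by omega)
  rcases Nat.eq_zero_or_pos s with hs0 | hs
  · subst hs0
    have : (3 * 0 + 2).choose 3 = 0 := by decide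
    rw [this]
    apply le_max_of_le_left
    simp only [Nat.sub_zero, Nat.sub_self, max_self]
    omega
  rcases le_total ((3 * s + 2).choose 3) (k.choose 3 - (k - s).choose 3) with h | h
  · rw [max_eq_left h]
    apply le_max_of_le_left
    omega
  · rw [max_eq_right h]
    apply le_max_of_le_right
    have hstar := star_real k s (by omega)
    have h' : ((k.choose 3 - (k - s).choose 3 : ℕ) : ℝ) ≤ ((3 * s + 2).choose 3 : ℕ) := by exact_mod_cast h
    rw [hstar, choose_three_real] at h'
    have goal' : ((k.choose 2 + (3 * s + 2).choose 3 : ℕ) : ℝ) ≤ ((3 * (s + 1) + 2).choose 3 : ℕ) := by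
      push_cast
      rw [choose_two_real, choose_three_real, choose_three_real]
      push_cast at h' ⊢
      have hk : 3 * (s:ℝ) + 5 ≤ k := by
        have : 3 * s + 5 ≤ k := by omega
        exact_mod_cast this
      · have hs' : (1:ℝ) ≤ s := by exact_mod_cast hs
        generalize (s:ℝ) = t at *
        generalize (k:ℝ) = x at *
        have h2 : 3 * x^2 - 3 * x * t + t^2 - 6 * x + 3 * t + 2 ≤ 27 * t^2 + 27 * t + 6 := by
          have : t * (3 * x^2 - 3 * x * t + t^2 - 6 * x + 3 * t + 2) ≤ t * (27 * t^2 + 27 * t + 6) := by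
            nlinarith
          exact le_of_mul_le_mul_left this (by linarith)
        have h3 : x ≤ 5 * t + 4 := by
          by_contra hcon
          push Not at hcon
          nlinarith
        nlinarith
    exact_mod_cast goal'

theorem arith_small (n s k l : ℕ) (hs : 1 ≤ s) (hn : 100 * s ≤ n) (hk : k ≤ (3 * s + 2).choose 3)
    (hl : l ≤ s * (3 * s + 2)) :
    k + (n - (3 * s + 2)) * l ≤ n.choose 3 - (n - s).choose 3 := by
  have h1 : k + (n - (3 * s + 2)) * l ≤ (3 * s + 2).choose 3 + (n - (3 * s + 2)) * (s * (3 * s + 2)) :=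
    Nat.add_le_add hk (Nat.mul_le_mul_left _ hl)
  refine h1.trans ?_
  have goal' : (((3 * s + 2).choose 3 + (n - (3 * s + 2)) * (s * (3 * s + 2)) : ℕ) : ℝ) ≤
      ((n.choose 3 - (n - s).choose 3 : ℕ) : ℝ) := by
    rw [star_real n s (by omega), Nat.cast_add, Nat.cast_mul, Nat.cast_sub (by omega), choose_three_real]
    push_cast
    have hs' : (1:ℝ) ≤ s := by exact_mod_cast hs
    have hn' : 100 * (s:ℝ) ≤ n := by exact_mod_cast hn
    generalize (s:ℝ) = t at *
    generalize (n:ℝ) = x at *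
    have : 0 ≤ (3 * x^2 - 3 * x * t + t^2 - 6 * x + 3 * t + 2) - ((27 * t^2 + 27 * t + 6) + 6 * ((x - (3 * t + 2)) * (3 * t + 2))) := by
      nlinarith
    nlinarith [mul_nonneg (by linarith : (0:ℝ) ≤ t) this]
  exact_mod_cast goal'

theorem arith_large (n s k l d : ℕ) (hs : 10000000 ≤ s) (hn : 3 * s + 3 ≤ n) (hk : d + k = (3 * s + 2).choose 3)
    (hd : 39 / 80 * (s:ℝ) * l ≤ d) (hl : (l:ℝ) ≤ 13 / 5 * (s:ℝ)^2) :
    k + (n - (3 * s + 2)) * l ≤ max (n.choose 3 - (n - s).choose 3) ((3 * s + 2).choose 3) := by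
  have hk' : (d:ℝ) + k = ((3 * s + 2).choose 3 : ℕ) := by exact_mod_cast hk
  have hc : ((k + (n - (3 * s + 2)) * l : ℕ) : ℝ) ≤ ((3 * s + 2).choose 3 : ℕ) + ((n:ℝ) - (3 * s + 2) - 39 / 80 * s) * l := by
    rw [Nat.cast_add, Nat.cast_mul, Nat.cast_sub (by omega)]
    push_cast
    linarith
  have hl0 : (0:ℝ) ≤ l := Nat.cast_nonneg _
  rcases le_total ((n:ℝ) - (3 * s + 2) - 39 / 80 * s) 0 with h | h
  · apply le_max_of_le_right
    have : ((k + (n - (3 * s + 2)) * l : ℕ) : ℝ) ≤ ((3 * s + 2).choose 3 : ℕ) := by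
      nlinarith
    exact_mod_cast this
  · apply le_max_of_le_left
    have : ((k + (n - (3 * s + 2)) * l : ℕ) : ℝ) ≤ ((n.choose 3 - (n - s).choose 3 : ℕ) : ℝ) := by
      refine hc.trans ?_
      have h2 := mul_le_mul_of_nonneg_left hl h
      rw [star_real n s (by omega), choose_three_real]
      push_cast
      have hs' : (10000000:ℝ) ≤ s := by exact_mod_cast hs
      refine (add_le_add_right h2 _).trans ?_
      clear h2 hc hk' hd hl hl0
      generalize (s:ℝ) = t at *
      obtain ⟨y, hy⟩ : ∃ y : ℝ, y = n - (3 * t + 2) - 39 / 80 * t := ⟨_, rfl⟩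
      have hx : (n:ℝ) = y + (3 * t + 2) + 39 / 80 * t := by linarith
      rw [← hy] at h ⊢
      rw [hx]
      clear hy hx
      have : 0 ≤ (3 * (y + (3 * t + 2) + 39 / 80 * t)^2 - 3 * (y + (3 * t + 2) + 39 / 80 * t) * t + t^2 - 6 * (y + (3 * t + 2) + 39 / 80 * t) + 3 * t + 2) - ((27 * t^2 + 27 * t + 6) + 6 * (y * (13 / 5 * t))) := by
        nlinarith [mul_nonneg h (by linarith : (0:ℝ) ≤ t), sq_nonneg y]
      nlinarith [mul_nonneg (by linarith : (0:ℝ) ≤ t) this]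
    exact_mod_cast this

theorem main_induct (G X : ℕ) (hG : 1000000 ≤ G) (hX : 4 ^ G = X) (s : ℕ) : ∀ n : ℕ, 3 * s + 3 ≤ n →
    100 * (1000000 * (X + 10)) ≤ n - s → ∀ F : Finset (Finset ℕ), (∀ e ∈ F, e ⊆ Icc 1 n ∧ e.card = 3) →
    ¬ HasM F (s + 1) → F.card ≤ max (n.choose 3 - (n - s).choose 3) ((3 * s + 2).choose 3) := by
  induction s with
  | zero =>
    intro n _ _ F _ hM
    have : F = ∅ := by
      rw [eq_empty_iff_forall_notMem]
      intro e he
      exact hM ⟨fun _ => e, fun _ => he, fun i j hij => absurd (Subsingleton.elim (α := Fin 1) i j) hij⟩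
    simp [this]
  | succ s ih =>
    intro n hn hns F0 h30 hM0
    obtain ⟨F, h3, hcard, hM, hF⟩ := exists_shifted n 3 (s + 1 + 1) F0 h30 hM0
    rw [← hcard]
    have h3' : ∀ e ∈ F, e.card = 3 := fun e he => (h3 e he).2
    by_cases hmem : ({1, 3 * (s + 1) + 2, 3 * (s + 1) + 3} : Finset ℕ) ∈ F
    · have h1 := step_noM hF n (s + 1) h3 hmem hM
      obtain ⟨F', h3F', hc', hM'⟩ := move_down _ n (s + 1) (fun e he => h3 e (mem_filter.1 he).1)
        (fun e he => (mem_filter.1 he).2) h1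
      have h2 := ih (n - 1) (by omega) (by
        have : n - 1 - s = n - (s + 1) := by omega
        rw [this]; exact hns) F' h3F' hM'
      have h4 := deg_one F n h3
      have h5 := step_arith n s (by omega)
      rw [← hc'] at h4
      omega
    · have hc := F_card_le hF n (s + 1) h3 hmem
      have hadd := miss_add (F := F) (s := s + 1) h3'
      have hLM : ¬ HasM (LL F (s + 1)) (s + 1 + 1) := fun h =>
        EE_noM hF h3' (s + 1) hM (h.mono subset_union_right)
      refine hc.trans ?_
      by_cases hs : 1000000 * (X + 10) ≤ s + 1
      · refine arith_large n (s + 1) _ _ _ ?_ hn hadd ?_ ?_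
        · linarith
        · exact main_lemma hF h3' (s + 1) G hM hG (by rw [hX]; exact hs)
        · refine graph_bound2 _ (LL_shift hF _) (s + 1) ?_ LL_spec hLM
          omega
      · apply le_max_of_le_left
        refine arith_small n (s + 1) _ _ (by omega) ?_ (by omega) ?_
        · clear hX; omega
        · exact graph_bound1 _ (LL_shift hF _) (3 * (s + 1) + 2) (s + 1) (by omega) LL_spec hLM

/-- the Łuczak–Mieczkowska theorem (Erdős matching conjecture for
3-graphs and large `n`). -/
theorem luczak_mieczkowska :
    ∃ n₁ : ℕ, 0 < n₁ ∧ ∀ n : ℕ, n ≥ n₁ → ∀ m : ℕ, 1 ≤ m → 3 * m ≤ n →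
      ∀ H : Finset (Finset ℕ), IsKGraphOn n 3 H → H.card > fEMC n m 3 →
        ∃ M ⊆ H, IsMatching M ∧ m ≤ M.card := by
  classical
  obtain ⟨G, hG⟩ : ∃ G : ℕ, 1000000 ≤ G := ⟨_, le_rfl⟩
  obtain ⟨X, hX⟩ : ∃ X : ℕ, 4 ^ G = X := ⟨_, rfl⟩
  refine ⟨200 * (1000000 * (X + 10)) + 1, Nat.succ_pos _, ?_⟩
  intro n hn m hm hmn H hH hcard
  obtain ⟨s, rfl⟩ : ∃ s, m = s + 1 := ⟨m - 1, by omega⟩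
  by_cases hM : HasM H (s + 1)
  · obtain ⟨g, hg, hd⟩ := hM
    have hinj : Function.Injective g := by
      intro i j hij
      by_contra hne
      have h1 := hd i j hne
      rw [← hij, disjoint_self, bot_eq_empty] at h1
      have h2 := (hH _ (hg i)).2
      rw [h1] at h2
      simp at h2
    refine ⟨univ.image g, ?_, ?_, ?_⟩
    · intro e he
      obtain ⟨i, _, rfl⟩ := mem_image.1 he
      exact hg i
    · intro e he f hf hef
      obtain ⟨i, _, rfl⟩ := mem_image.1 he
      obtain ⟨j, _, rfl⟩ := mem_image.1 hf
      exact hd i j (fun h => hef (by rw [h]))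
    · rw [card_image_of_injective _ hinj, card_univ, Fintype.card_fin]
  · exfalso
    have h := main_induct G X hG hX s n (by omega) (Nat.le_sub_of_add_le (by linarith)) H hH hM
    unfold fEMC at hcard
    have e1 : n - (s + 1) + 1 = n - s := by omega
    have e2 : 3 * (s + 1) - 1 = 3 * s + 2 := by omega
    rw [e1, e2] at hcard
    omega
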